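/- arXiv:1912.10936 — 2 statements merged into one kernel-verified Lean document; each statement's English description precedes it below -/
import Mathlib

section
/- For every d ∈ ℕ the linear rigidity property holds for the family of all locally finite ℝ^d-valued Borel measures on ℝ^d: if ν is a locally finite ℝ^d-valued Borel measure with polar decomposition ν = τ|ν| (|τ(x)| = 1 for |ν|-a.e. x), c > 0 is a constant, and (i) |ν|({x ∈ ℝ^d : x_d ≤ 0}) = 0, (ii) div ν = 0 in the distributional sense, and (iii) the d-th component satisfies τ_d(x) ≥ c for |ν|-a.e. x ∈ ℝ^d, then ν = 0. -/
open MeasureTheory Filter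
open scoped ENNReal NNReal

noncomputable section

abbrev Ed (d : ℕ) : Type := EuclideanSpace ℝ (Fin d)

theorem expNegInvGlue_deriv_pos {s : ℝ} (hs : 0 < s) : 0 < deriv expNegInvGlue s := by
  have h : expNegInvGlue =ᶠ[nhds s] fun y => Real.exp (-y⁻¹) := by
    filter_upwards [lt_mem_nhds hs] with y hy
    simp [expNegInvGlue, not_le.2 hy]
  have hd : HasDerivAt (fun y : ℝ => Real.exp (-y⁻¹)) _ s := (hasDerivAt_inv hs.ne').neg.exp
  rw [h.deriv_eq, hd.deriv, neg_neg]
  exact mul_pos (Real.exp_pos _) (by positivity)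

/-- A function whose superlevel sets, cut by a half-space bounded below in the last coordinate,
are bounded, and which decreases along unit vectors with last component larger than `K⁻¹`. -/
def coneHeight (d : ℕ) (A K : ℝ) (x : Ed (d + 1)) : ℝ :=
  A - K * x (Fin.last d) - √(1 + ‖x‖ ^ 2)

theorem contDiff_coneHeight (d : ℕ) (A K : ℝ) :
    ContDiff ℝ (⊤ : ℕ∞) (coneHeight d A K) := by
  unfold coneHeight
  have h1 : ContDiff ℝ (⊤ : ℕ∞) fun x : Ed (d + 1) => x (Fin.last d) :=
    (EuclideanSpace.proj (𝕜 := ℝ) (Fin.last d)).contDiff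
  have h2 : ContDiff ℝ (⊤ : ℕ∞) fun x : Ed (d + 1) => √(1 + ‖x‖ ^ 2) :=
    (contDiff_const.add (contDiff_norm_sq ℝ)).sqrt fun x => by positivity
  exact (contDiff_const.sub (contDiff_const.mul h1)).sub h2

theorem fderiv_coneHeight_le (d : ℕ) (A K : ℝ) (x v : Ed (d + 1)) :
    fderiv ℝ (coneHeight d A K) x v ≤ ‖v‖ - K * v (Fin.last d) := by
  have h1 : HasFDerivAt (fun x : Ed (d + 1) => x (Fin.last d))
      (EuclideanSpace.proj (𝕜 := ℝ) (Fin.last d)) x :=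
    (EuclideanSpace.proj (𝕜 := ℝ) (Fin.last d)).hasFDerivAt
  have h2 := ((hasStrictFDerivAt_norm_sq x).hasFDerivAt.const_add 1).sqrt
    (by positivity : (1 : ℝ) + ‖x‖ ^ 2 ≠ 0)
  have h3 : HasFDerivAt (coneHeight d A K) _ x := ((h1.const_mul K).const_sub A).sub h2
  have hs : 0 < √(1 + ‖x‖ ^ 2) := by positivity
  have hx : ‖x‖ ≤ √(1 + ‖x‖ ^ 2) := Real.le_sqrt_of_sq_le (by linarith)
  have hi : -(‖x‖ * ‖v‖) ≤ inner ℝ x v := neg_le_of_abs_le (abs_real_inner_le_norm x v)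
  have key : -‖v‖ ≤ inner ℝ x v / √(1 + ‖x‖ ^ 2) := by
    rw [le_div_iff₀ hs]
    nlinarith [mul_le_mul_of_nonneg_right hx (norm_nonneg v)]
  rw [h3.fderiv]
  have e : 1 / (2 * √(1 + ‖x‖ ^ 2)) * (2 * inner ℝ x v) = inner ℝ x v / √(1 + ‖x‖ ^ 2) := by
    field_simp
  simp [-one_div, -mul_inv_rev] at *
  linarith

/-- The composition of `coneHeight` with a smooth step, cut off below the upper half-space. -/
def coneTest (d : ℕ) (A K : ℝ) (x : Ed (d + 1)) : ℝ :=
  expNegInvGlue (coneHeight d A K x) * Real.smoothTransition (x (Fin.last d) + 1)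

theorem contDiff_coneTest (d : ℕ) (A K : ℝ) : ContDiff ℝ (⊤ : ℕ∞) (coneTest d A K) := by
  have h1 : ContDiff ℝ (⊤ : ℕ∞) fun x : Ed (d + 1) => x (Fin.last d) :=
    (EuclideanSpace.proj (𝕜 := ℝ) (Fin.last d)).contDiff
  exact (expNegInvGlue.contDiff.comp (contDiff_coneHeight d A K)).mul
    (Real.smoothTransition.contDiff.comp (h1.add contDiff_const))

theorem hasCompactSupport_coneTest (d : ℕ) (A : ℝ) {K : ℝ} (hK : 0 ≤ K) :
    HasCompactSupport (coneTest d A K) := by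
  refine HasCompactSupport.intro (isCompact_closedBall (0 : Ed (d + 1)) (A + K)) fun x hx => ?_
  rw [mem_closedBall_zero_iff, not_le] at hx
  unfold coneTest
  rcases le_or_gt (x (Fin.last d) + 1) 0 with ht | ht
  · rw [Real.smoothTransition.zero_of_nonpos ht, mul_zero]
  · have hs : ‖x‖ ≤ √(1 + ‖x‖ ^ 2) := Real.le_sqrt_of_sq_le (by linarith)
    rw [expNegInvGlue.zero_of_nonpos, zero_mul]
    unfold coneHeight
    nlinarith

theorem fderiv_coneTest (d : ℕ) (A K : ℝ) {x : Ed (d + 1)} (hx : 0 < x (Fin.last d))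
    (v : Ed (d + 1)) :
    fderiv ℝ (coneTest d A K) x v =
      deriv expNegInvGlue (coneHeight d A K x) * fderiv ℝ (coneHeight d A K) x v := by
  have hc : Continuous fun x : Ed (d + 1) => x (Fin.last d) :=
    (EuclideanSpace.proj (𝕜 := ℝ) (Fin.last d)).continuous
  have h : coneTest d A K =ᶠ[nhds x] expNegInvGlue ∘ coneHeight d A K := by
    filter_upwards [hc.continuousAt.eventually (lt_mem_nhds hx)] with y hy
    rw [coneTest, Real.smoothTransition.one_of_one_le (by linarith), mul_one,
      Function.comp_apply]
  have hg : DifferentiableAt ℝ expNegInvGlue (coneHeight d A K x) :=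
    (expNegInvGlue.contDiff (n := 1)).differentiable one_ne_zero _
  have hh : DifferentiableAt ℝ (coneHeight d A K) x :=
    (contDiff_coneHeight d A K).differentiable (by simp) _
  rw [h.fderiv_eq, (hg.hasDerivAt.comp_hasFDerivAt x hh.hasFDerivAt).fderiv]
  simp

theorem integrable_fderiv_apply {E : Type*} [NormedAddCommGroup E] [NormedSpace ℝ E]
    [FiniteDimensional ℝ E] [MeasurableSpace E] [BorelSpace E] {μ : Measure E}
    [IsLocallyFiniteMeasure μ] {τ : E → E} (hτ : Measurable τ) (hτ1 : ∀ᵐ x ∂μ, ‖τ x‖ ≤ 1)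
    {φ : E → ℝ} (hφ : ContDiff ℝ 1 φ) (hs : HasCompactSupport φ) :
    Integrable (fun x => fderiv ℝ φ x (τ x)) μ := by
  have hc : Continuous (fderiv ℝ φ) := hφ.continuous_fderiv one_ne_zero
  have hi : Integrable (fderiv ℝ φ) μ := hc.integrable_of_hasCompactSupport (hs.fderiv ℝ)
  refine hi.norm.mono' ?_ ?_
  · exact ((isBoundedBilinearMap_apply (𝕜 := ℝ) (E := E) (F := ℝ)).continuous.measurable.comp
      (hc.measurable.prodMk hτ)).aestronglyMeasurable
  · filter_upwards [hτ1] with x hx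
    exact (fderiv ℝ φ x).le_of_opNorm_le_of_le le_rfl hx |>.trans (mul_one _).le

/-- **Linear rigidity** holds in every dimension: a locally finite vector measure
`ν = τ|ν|` on `ℝ^(d+1)` which vanishes on the lower half-space `{x_d ≤ 0}`, is
divergence-free, and whose polar density has last component bounded below by `c > 0`,
is identically zero. -/
theorem linear_rigidity (d : ℕ)
    (σν : Measure (Ed (d + 1))) [IsLocallyFiniteMeasure σν]
    (τ : Ed (d + 1) → Ed (d + 1)) (hτm : Measurable τ)
    (hτ1 : ∀ᵐ x ∂σν, ‖τ x‖ = 1)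
    (c : ℝ) (hc : 0 < c)
    -- (i) ν vanishes on the lower half-space
    (hhalf : σν {x : Ed (d + 1) | x (Fin.last d) ≤ 0} = 0)
    -- (ii) div ν = 0 in the distributional sense
    (hdiv : ∀ φ : Ed (d + 1) → ℝ, ContDiff ℝ (⊤ : ℕ∞) φ → HasCompactSupport φ →
      ∫ x, fderiv ℝ φ x (τ x) ∂σν = 0)
    -- (iii) τ_d ≥ c  |ν|-a.e.
    (hlow : ∀ᵐ x ∂σν, c ≤ τ x (Fin.last d)) :
    σν = 0 := by
  have hpos : ∀ᵐ x ∂σν, 0 < x (Fin.last d) := by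
    rw [ae_iff]
    simpa only [not_lt] using hhalf
  have hK : 0 ≤ 2 / c := by positivity
  have hle : ∀ A : ℝ, ∀ᵐ x ∂σν, coneHeight d A (2 / c) x ≤ 0 := fun A => by
    have hv : ∀ᵐ x ∂σν, fderiv ℝ (coneHeight d A (2 / c)) x (τ x) < 0 := by
      filter_upwards [hτ1, hlow] with x h1 hl
      have h := fderiv_coneHeight_le d A (2 / c) x (τ x)
      have h2 : 2 / c * c ≤ 2 / c * τ x (Fin.last d) := mul_le_mul_of_nonneg_left hl hK
      rw [div_mul_cancel₀ _ hc.ne'] at h2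
      linarith
    have hi := integrable_fderiv_apply hτm (hτ1.mono fun _ h => h.le)
      ((contDiff_coneTest d A (2 / c)).of_le (by exact_mod_cast le_top))
      (hasCompactSupport_coneTest d A hK)
    have h0 := hdiv _ (contDiff_coneTest d A (2 / c)) (hasCompactSupport_coneTest d A hK)
    have hn : 0 ≤ᵐ[σν] fun x => -fderiv ℝ (coneTest d A (2 / c)) x (τ x) := by
      filter_upwards [hpos, hv] with x hx hxv
      rw [fderiv_coneTest d A _ hx, Pi.zero_apply, neg_nonneg]
      exact mul_nonpos_of_nonneg_of_nonpos expNegInvGlue.monotone.deriv_nonneg hxv.le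
    have hz := (integral_eq_zero_iff_of_nonneg_ae hn hi.neg).1
      (by rw [integral_neg, h0, neg_zero])
    filter_upwards [hz, hpos, hv] with x hx0 hx hxv
    by_contra! hgt
    rw [fderiv_coneTest d A _ hx, Pi.zero_apply, neg_eq_zero] at hx0
    exact (mul_neg_of_pos_of_neg (expNegInvGlue_deriv_pos hgt) hxv).ne hx0
  have hall : ∀ᵐ x ∂σν, ∀ n : ℕ, coneHeight d n (2 / c) x ≤ 0 := ae_all_iff.2 fun n => hle n
  rw [← ae_eq_bot, ← eventually_false_iff_eq_bot]
  filter_upwards [hall] with x hx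
  obtain ⟨n, hn⟩ := exists_nat_gt (2 / c * x (Fin.last d) + √(1 + ‖x‖ ^ 2))
  have := hx n
  unfold coneHeight at this
  linarith
end
end

section
/- Let F ⊆ E ⊂ ℝ^d be two sets of finite perimeter. Then ∂^e F ⊆ ∂^e E up to an H^{d−1}-negligible set if and only if H^{d−1}(∂^e F ∩ E^1) = 0. Furthermore, if E is indecomposable and one (hence both) of these equivalent conditions holds, then L^d(F) = 0 or L^d(E ∖ F) = 0. -/
open MeasureTheory Filter
open scoped ENNReal

noncomputable section

/-- Divergence of a vector field on `ℝ^d`. -/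
def vdiv {d : ℕ} (φ : Ed d → Ed d) (x : Ed d) : ℝ :=
  ∑ i, fderiv ℝ φ x (EuclideanSpace.single i 1) i

/-- The variation `V(u, Ω)` of a locally integrable function on an (open) set `Ω`. -/
def variationOn {d : ℕ} (u : Ed d → ℝ) (Ω : Set (Ed d)) : ℝ≥0∞ :=
  ⨆ φ : {φ : Ed d → Ed d // ContDiff ℝ (⊤ : ℕ∞) φ ∧ HasCompactSupport φ ∧
      tsupport φ ⊆ Ω ∧ ∀ x, ‖φ x‖ ≤ 1},
    ENNReal.ofReal (∫ x in Ω, u x * vdiv φ.1 x)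

/-- The total variation `V(u) = V(u, ℝ^d)`. -/
def variation {d : ℕ} (u : Ed d → ℝ) : ℝ≥0∞ := variationOn u Set.univ

/-- The perimeter of a set `E ⊆ ℝ^d`. -/
def perimeter {d : ℕ} (E : Set (Ed d)) : ℝ≥0∞ :=
  variation (E.indicator fun _ => (1 : ℝ))

/-- A set of finite perimeter is decomposable if it splits into two disjoint pieces of positive
measure whose perimeters add up to the perimeter of the set. -/
def Decomposable {d : ℕ} (E : Set (Ed d)) : Prop :=
  ∃ A B : Set (Ed d), MeasurableSet A ∧ MeasurableSet B ∧ E = A ∪ B ∧ A ∩ B = ∅ ∧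
    0 < volume A ∧ 0 < volume B ∧ perimeter E = perimeter A + perimeter B

def Indecomposable {d : ℕ} (E : Set (Ed d)) : Prop := ¬ Decomposable E

/-- `x` is a point of density `t` for `E`. -/
def densityPt {d : ℕ} (E : Set (Ed d)) (t : ℝ≥0∞) (x : Ed d) : Prop :=
  Tendsto (fun r : ℝ => volume (E ∩ Metric.ball x r) / volume (Metric.ball x r))
    (nhdsWithin 0 (Set.Ioi 0)) (nhds t)

/-- The set `E^t` of points of density `t` of `E`. -/
def densitySet {d : ℕ} (E : Set (Ed d)) (t : ℝ≥0∞) : Set (Ed d) := {x | densityPt E t x}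

/-- The essential boundary `∂^e E = ℝ^d ∖ (E^0 ∪ E^1)`. -/
def essBoundary {d : ℕ} (E : Set (Ed d)) : Set (Ed d) :=
  (densitySet E 0 ∪ densitySet E 1)ᶜ

/-- The points of `A` that a translation by `s` moves out of `A`, and conversely. -/
def jumpSet {X : Type*} [Add X] (A : Set X) (s : X) : Set X := {t | ¬(t ∈ A ↔ t + s ∈ A)}

/-- The dyadic step `2⁻ⁿ`. -/
def dyadic (n : ℕ) : ℝ := (1 / 2 : ℝ) ^ n

theorem dyadic_pos (n : ℕ) : 0 < dyadic n := by unfold dyadic; positivity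

theorem tendsto_dyadic : Tendsto dyadic atTop (nhds 0) :=
  tendsto_pow_atTop_nhds_zero_of_lt_one (by norm_num) (by norm_num)

theorem tendsto_dyadic_pos : Tendsto dyadic atTop (nhdsWithin 0 (Set.Ioi 0)) :=
  tendsto_nhdsWithin_iff.2 ⟨tendsto_dyadic, Eventually.of_forall dyadic_pos⟩

theorem measurableSet_jumpSet {X : Type*} [Add X] [MeasurableSpace X] [MeasurableAdd X]
    {A : Set X} (hA : MeasurableSet A) (s : X) : MeasurableSet (jumpSet A s) := by
  have h2 : MeasurableSet {t | t + s ∈ A} := hA.preimage (measurable_add_const s)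
  exact (MeasurableSet.iff hA h2).compl

theorem jumpSet_compl {X : Type*} [Add X] (A : Set X) (s : X) : jumpSet Aᶜ s = jumpSet A s := by
  ext t; simp only [jumpSet, Set.mem_ofPred_eq, Set.mem_compl_iff]; tauto

theorem exists_onesided_density {A I : Set ℝ} (hA : MeasurableSet A) (hI : MeasurableSet I)
    (h : volume (I ∩ A) ≠ 0) :
    ∃ a ∈ I, ∀ᶠ n in atTop,
      3 / 4 * dyadic n ≤ volume.real (A ∩ Set.Icc a (a + dyadic n)) := by
  have hne : (ae (volume.restrict (I ∩ A))).NeBot := by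
    rw [ae_neBot]
    simpa [Measure.restrict_eq_zero] using h
  obtain ⟨a, ha, ha'⟩ := ((IsUnifLocDoublingMeasure.ae_tendsto_measure_inter_div
    (volume : Measure ℝ) (I ∩ A) 1).and (ae_restrict_mem (hI.inter hA))).exists
  refine ⟨a, ha'.1, ?_⟩
  have hlim : Tendsto (fun n => dyadic n / 2) atTop (nhdsWithin 0 (Set.Ioi 0)) := by
    refine tendsto_nhdsWithin_iff.2 ⟨by simpa using tendsto_dyadic.div_const 2, ?_⟩
    exact Eventually.of_forall fun n => half_pos (dyadic_pos n)
  have key := ha (fun n => a + dyadic n / 2) (fun n => dyadic n / 2) hlim (by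
    refine Eventually.of_forall fun n => ?_
    have := dyadic_pos n
    rw [Metric.mem_closedBall, Real.dist_eq, abs_le]; constructor <;> linarith)
  have h34 : (3 / 4 : ℝ≥0∞) < 1 := by
    rw [ENNReal.div_lt_iff] <;> norm_num
  filter_upwards [key.eventually (lt_mem_nhds h34)] with n hn
  have hp := dyadic_pos n
  have hball : Metric.closedBall (a + dyadic n / 2) (dyadic n / 2)
      = Set.Icc a (a + dyadic n) := by
    rw [Real.closedBall_eq_Icc]; congr 1 <;> ring
  rw [hball, Real.volume_Icc, add_sub_cancel_left, ENNReal.lt_div_iff_mul_lt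
    (Or.inl (by simpa using hp)) (Or.inl (by simp))] at hn
  have h1 : (3 / 4 : ℝ≥0∞) * ENNReal.ofReal (dyadic n) = ENNReal.ofReal (3 / 4 * dyadic n) := by
    rw [ENNReal.ofReal_mul (by norm_num), ENNReal.ofReal_div_of_pos (by norm_num)]; simp
  rw [h1] at hn
  have h2 : ENNReal.ofReal (3 / 4 * dyadic n) ≤ volume (A ∩ Set.Icc a (a + dyadic n)) :=
    hn.le.trans (measure_mono (by gcongr; exact Set.inter_subset_right))
  refine (ENNReal.ofReal_le_iff_le_toReal ?_).1 h2
  exact ((measure_mono Set.inter_subset_right).trans_lt (by simp)).ne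

theorem crossing_le_jumpSet {A : Set ℝ} (hA : MeasurableSet A) {a b s : ℝ} (hab : a ≤ b)
    (hs : 0 < s) (h1 : 3 / 4 * s ≤ volume.real (A ∩ Set.Icc a (a + s)))
    (h2 : 3 / 4 * s ≤ volume.real (Aᶜ ∩ Set.Icc b (b + s))) :
    s / 2 ≤ volume.real (jumpSet A s ∩ Set.Ioc a b) := by
  have hfin : ∀ (S : Set ℝ) (x y : ℝ), volume (S ∩ Set.Ioc x y) ≠ ⊤ := fun S x y =>
    ((measure_mono Set.inter_subset_right).trans_lt (by simp)).ne
  have split : ∀ x y z : ℝ, x ≤ y → y ≤ z → volume.real (A ∩ Set.Ioc x z) =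
      volume.real (A ∩ Set.Ioc x y) + volume.real (A ∩ Set.Ioc y z) := by
    intro x y z hxy hyz
    rw [← measureReal_union _ (hA.inter measurableSet_Ioc) (hfin _ _ _) (hfin _ _ _),
      ← Set.inter_union_distrib_left, Set.Ioc_union_Ioc_eq_Ioc hxy hyz]
    exact (Set.Ioc_disjoint_Ioc_of_le le_rfl).mono Set.inter_subset_right Set.inter_subset_right
  have hIcc : ∀ (S : Set ℝ) (x y : ℝ), volume.real (S ∩ Set.Icc x y)
      = volume.real (S ∩ Set.Ioc x y) := fun S x y =>
    measureReal_congr ((ae_eq_refl S).inter Ioc_ae_eq_Icc.symm)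
  rw [hIcc] at h1 h2
  have hb : volume.real (A ∩ Set.Ioc b (b + s)) + volume.real (Aᶜ ∩ Set.Ioc b (b + s)) = s := by
    rw [← measureReal_union _ (hA.compl.inter measurableSet_Ioc) (hfin _ _ _) (hfin _ _ _),
      ← Set.union_inter_distrib_right, Set.union_compl_self, Set.univ_inter]
    · simp [Measure.real, hs.le]
    · exact disjoint_compl_right.mono Set.inter_subset_left Set.inter_subset_left
  have hshift : volume.real (A ∩ Set.Ioc (a + s) (b + s))
      = volume.real ({t | t + s ∈ A} ∩ Set.Ioc a b) := by
    have := measure_preimage_add_right volume s (A ∩ Set.Ioc (a + s) (b + s))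
    simp only [Measure.real]
    rw [← this]
    congr 2
    ext t; simp
  have hsub : volume.real (A ∩ Set.Ioc a b) ≤ volume.real ({t | t + s ∈ A} ∩ Set.Ioc a b)
      + volume.real (jumpSet A s ∩ Set.Ioc a b) := by
    refine le_trans (measureReal_mono ?_ ?_) (measureReal_union_le _ _)
    · rintro t ⟨h, h'⟩
      by_cases h3 : t + s ∈ A
      · exact Or.inl ⟨h3, h'⟩
      · exact Or.inr ⟨by simp [jumpSet, h, h3], h'⟩
    · exact (measure_union_lt_top (hfin _ _ _).lt_top (hfin _ _ _).lt_top).ne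
  have e1 := split a (a + s) (b + s) (by linarith) (by linarith)
  have e2 := split a b (b + s) hab (by linarith)
  linarith

theorem exists_crossing {A I : Set ℝ} (hA : MeasurableSet A) (hI : MeasurableSet I)
    (h : volume (I ∩ A) ≠ 0) (h' : volume (I \ A) ≠ 0) :
    ∃ a ∈ I, ∃ b ∈ I, ∀ᶠ n in atTop,
      ENNReal.ofReal (dyadic n / 2) ≤ volume (jumpSet A (dyadic n) ∩ Set.Ioc a b) := by
  obtain ⟨a, haI, ha⟩ := exists_onesided_density hA hI h
  obtain ⟨b, hbI, hb⟩ := exists_onesided_density hA.compl hI h'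
  rcases le_total a b with hab | hab
  · refine ⟨a, haI, b, hbI, ?_⟩
    filter_upwards [ha, hb] with n h1 h2
    exact ENNReal.ofReal_le_of_le_toReal (crossing_le_jumpSet hA hab (dyadic_pos n) h1 h2)
  · refine ⟨b, hbI, a, haI, ?_⟩
    filter_upwards [ha, hb] with n h1 h2
    rw [← jumpSet_compl]
    refine ENNReal.ofReal_le_of_le_toReal
      (crossing_le_jumpSet hA.compl hab (dyadic_pos n) h2 ?_)
    rwa [compl_compl]

/-- A set of finite variation on the line is constant, up to a null set, on the small members of a
shrinking family of intervals. -/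
theorem exists_interval_ae_const {A : Set ℝ} (hA : MeasurableSet A) {M : ℝ≥0∞} (hM : M ≠ ⊤)
    (hAM : ∀ n, volume (jumpSet A (dyadic n)) ≤ M * ENNReal.ofReal (dyadic n))
    {I : ℕ → Set ℝ} (hanti : Antitone I) (hIm : ∀ n, MeasurableSet (I n))
    (hord : ∀ n, (I n).OrdConnected)
    (hI : ∀ n, ∀ a ∈ I n, ∀ b ∈ I n, ∃ m, Disjoint (Set.Icc a b) (I m)) :
    ∃ n, (∀ᵐ t, t ∈ I n → t ∈ A) ∨ (∀ᵐ t, t ∈ I n → t ∉ A) := by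
  by_contra! hcon
  have mixed : ∀ n, volume (I n ∩ A) ≠ 0 ∧ volume (I n \ A) ≠ 0 := by
    intro n
    refine ⟨fun h0 => (hcon n).2 ?_, fun h0 => (hcon n).1 ?_⟩
    · filter_upwards [measure_eq_zero_iff_ae_notMem.1 h0] with t ht h1 using ht h1
    · filter_upwards [measure_eq_zero_iff_ae_notMem.1 h0] with t ht h1 using ht h1
  have claim : ∀ k : ℕ, ∃ m, ∀ᶠ n in atTop,
      k * ENNReal.ofReal (dyadic n / 2) ≤ volume (jumpSet A (dyadic n) \ I m) := by
    intro k
    induction k with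
    | zero => exact ⟨0, by simp⟩
    | succ k ih =>
      obtain ⟨m, hm⟩ := ih
      obtain ⟨a, ha, b, hb, hab⟩ := exists_crossing hA (hIm m) (mixed m).1 (mixed m).2
      obtain ⟨m', hm'⟩ := hI m a ha b hb
      refine ⟨max m m', ?_⟩
      filter_upwards [hm, hab] with n h1 h2
      have hsub : Set.Ioc a b ⊆ I m := Set.Ioc_subset_Icc_self.trans ((hord m).out ha hb)
      calc ((k + 1 : ℕ) : ℝ≥0∞) * ENNReal.ofReal (dyadic n / 2)
          = k * ENNReal.ofReal (dyadic n / 2) + ENNReal.ofReal (dyadic n / 2) := by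
            push_cast; ring
        _ ≤ volume (jumpSet A (dyadic n) \ I m)
            + volume (jumpSet A (dyadic n) ∩ Set.Ioc a b) := add_le_add h1 h2
        _ = volume ((jumpSet A (dyadic n) \ I m) ∪ (jumpSet A (dyadic n) ∩ Set.Ioc a b)) := by
            refine (measure_union ?_ ((measurableSet_jumpSet hA _).inter measurableSet_Ioc)).symm
            exact (Set.disjoint_sdiff_left.mono_right hsub).mono_right Set.inter_subset_right
        _ ≤ _ := by
            refine measure_mono (Set.union_subset ?_ ?_)
            · exact Set.sdiff_subset_sdiff_right (hanti (le_max_left _ _))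
            · rintro t ⟨h3, h4⟩
              exact ⟨h3, fun h5 => Set.disjoint_left.1 hm' (Set.Ioc_subset_Icc_self h4)
                (hanti (le_max_right _ _) h5)⟩
  obtain ⟨k, hk⟩ := ENNReal.exists_nat_gt (r := M * 2) (ENNReal.mul_ne_top hM (by simp))
  obtain ⟨m, hm⟩ := claim k
  obtain ⟨n, hn⟩ := hm.exists
  have h3 := hn.trans ((measure_mono Set.sdiff_subset).trans (hAM n))
  have h4 : ENNReal.ofReal (dyadic n) = 2 * ENNReal.ofReal (dyadic n / 2) := by
    rw [ENNReal.ofReal_div_of_pos (by norm_num), ENNReal.ofReal_ofNat,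
      ENNReal.mul_div_cancel (by simp) (by simp)]
  rw [h4, ← mul_assoc] at h3
  have h5 : (k : ℝ≥0∞) ≤ M * 2 := by
    refine (ENNReal.mul_le_mul_iff_left ?_ ENNReal.ofReal_ne_top).1 h3
    simpa using dyadic_pos n
  exact absurd hk (not_lt.2 h5)

theorem exists_right_ae_const {A : Set ℝ} (hA : MeasurableSet A) {M : ℝ≥0∞} (hM : M ≠ ⊤)
    (hAM : ∀ n, volume (jumpSet A (dyadic n)) ≤ M * ENNReal.ofReal (dyadic n)) (t : ℝ) :
    ∃ δ > 0, (∀ᵐ τ, τ ∈ Set.Ioo t (t + δ) → τ ∈ A) ∨ (∀ᵐ τ, τ ∈ Set.Ioo t (t + δ) → τ ∉ A) := by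
  obtain ⟨n, hn⟩ := exists_interval_ae_const hA hM hAM (I := fun n => Set.Ioo t (t + dyadic n))
    (fun m n h => Set.Ioo_subset_Ioo_right (by
      have : dyadic n ≤ dyadic m := pow_le_pow_of_le_one (by norm_num) (by norm_num) h
      linarith)) (fun _ => measurableSet_Ioo) (fun _ => Set.ordConnected_Ioo) (by
      intro n a ha b hb
      obtain ⟨m, hm⟩ := (tendsto_dyadic.eventually (gt_mem_nhds (sub_pos.2 ha.1))).exists
      refine ⟨m, Set.disjoint_left.2 fun x hx hx' => ?_⟩
      linarith [hx.1, hx'.2])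
  exact ⟨dyadic n, dyadic_pos n, hn⟩

theorem exists_left_ae_const {A : Set ℝ} (hA : MeasurableSet A) {M : ℝ≥0∞} (hM : M ≠ ⊤)
    (hAM : ∀ n, volume (jumpSet A (dyadic n)) ≤ M * ENNReal.ofReal (dyadic n)) (t : ℝ) :
    ∃ δ > 0, (∀ᵐ τ, τ ∈ Set.Ioo (t - δ) t → τ ∈ A) ∨ (∀ᵐ τ, τ ∈ Set.Ioo (t - δ) t → τ ∉ A) := by
  obtain ⟨n, hn⟩ := exists_interval_ae_const hA hM hAM (I := fun n => Set.Ioo (t - dyadic n) t)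
    (fun m n h => Set.Ioo_subset_Ioo_left (by
      have : dyadic n ≤ dyadic m := pow_le_pow_of_le_one (by norm_num) (by norm_num) h
      linarith)) (fun _ => measurableSet_Ioo) (fun _ => Set.ordConnected_Ioo) (by
      intro n a ha b hb
      obtain ⟨m, hm⟩ := (tendsto_dyadic.eventually (gt_mem_nhds (sub_pos.2 hb.2))).exists
      refine ⟨m, Set.disjoint_left.2 fun x hx hx' => ?_⟩
      linarith [hx.2, hx'.1])
  exact ⟨dyadic n, dyadic_pos n, hn⟩

theorem exists_top_ae_const {A : Set ℝ} (hA : MeasurableSet A) {M : ℝ≥0∞} (hM : M ≠ ⊤)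
    (hAM : ∀ n, volume (jumpSet A (dyadic n)) ≤ M * ENNReal.ofReal (dyadic n)) :
    ∃ R : ℝ, (∀ᵐ τ, τ ∈ Set.Ioi R → τ ∈ A) ∨ (∀ᵐ τ, τ ∈ Set.Ioi R → τ ∉ A) := by
  obtain ⟨n, hn⟩ := exists_interval_ae_const hA hM hAM (I := fun n : ℕ => Set.Ioi (n : ℝ))
    (fun m n h => Set.Ioi_subset_Ioi (by exact_mod_cast h)) (fun _ => measurableSet_Ioi)
    (fun _ => Set.ordConnected_Ioi) (by
      intro n a ha b hb
      obtain ⟨m, hm⟩ := exists_nat_gt b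
      refine ⟨m, Set.disjoint_left.2 fun x hx hx' => ?_⟩
      have := hx.2
      rw [Set.mem_Ioi] at hx'
      linarith)
  exact ⟨n, hn⟩

theorem exists_bot_ae_const {A : Set ℝ} (hA : MeasurableSet A) {M : ℝ≥0∞} (hM : M ≠ ⊤)
    (hAM : ∀ n, volume (jumpSet A (dyadic n)) ≤ M * ENNReal.ofReal (dyadic n)) :
    ∃ R : ℝ, (∀ᵐ τ, τ ∈ Set.Iio (-R) → τ ∈ A) ∨ (∀ᵐ τ, τ ∈ Set.Iio (-R) → τ ∉ A) := by
  obtain ⟨n, hn⟩ := exists_interval_ae_const hA hM hAM (I := fun n : ℕ => Set.Iio (-(n : ℝ)))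
    (fun m n h => Set.Iio_subset_Iio (by simpa using h)) (fun _ => measurableSet_Iio)
    (fun _ => Set.ordConnected_Iio) (by
      intro n a ha b hb
      obtain ⟨m, hm⟩ := exists_nat_gt (-a)
      refine ⟨m, Set.disjoint_left.2 fun x hx hx' => ?_⟩
      have := hx.1
      rw [Set.mem_Iio] at hx'
      linarith)
  exact ⟨n, hn⟩

/-- `F` fills a right neighbourhood of `t` and `G` a left neighbourhood, up to null sets. -/
def Contact (F G : Set ℝ) (t : ℝ) : Prop :=
  ∃ δ > 0, (∀ᵐ τ, τ ∈ Set.Ioo t (t + δ) → τ ∈ F) ∧ (∀ᵐ τ, τ ∈ Set.Ioo (t - δ) t → τ ∈ G)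

theorem ae_shift {P : ℝ → Prop} (s : ℝ) (h : ∀ᵐ τ, P τ) : ∀ᵐ τ, P (τ + s) :=
  (measurePreserving_add_right volume s).quasiMeasurePreserving.ae h

theorem exists_nhd_ae_not_cross {F G : Set ℝ} (hF : MeasurableSet F) (hG : MeasurableSet G)
    (hFG : Disjoint F G) {M : ℝ≥0∞} (hM : M ≠ ⊤)
    (hFM : ∀ n, volume (jumpSet F (dyadic n)) ≤ M * ENNReal.ofReal (dyadic n))
    (hGM : ∀ n, volume (jumpSet G (dyadic n)) ≤ M * ENNReal.ofReal (dyadic n))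
    {t : ℝ} (hc : ¬ Contact F G t) :
    ∃ δ > 0, ∀ s > 0, ∀ᵐ τ, τ ∈ Metric.ball t δ → τ + s ∈ Metric.ball t δ → τ ∈ G →
      τ + s ∉ F := by
  obtain ⟨δ₁, hδ₁, h1⟩ := exists_right_ae_const hF hM hFM t
  obtain ⟨δ₂, hδ₂, h2⟩ := exists_left_ae_const hF hM hFM t
  obtain ⟨δ₃, hδ₃, h3⟩ := exists_left_ae_const hG hM hGM t
  have hnot : ∀ x, x ∈ G → x ∉ F := fun x hx hx' => Set.disjoint_left.1 hFG hx' hx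
  refine ⟨min δ₁ (min δ₂ δ₃), lt_min hδ₁ (lt_min hδ₂ hδ₃), fun s hs => ?_⟩
  have hb : ∀ x, x ∈ Metric.ball t (min δ₁ (min δ₂ δ₃)) → x < t + δ₁ ∧ t - δ₂ < x ∧ t - δ₃ < x := by
    intro x hx
    rw [Metric.mem_ball, Real.dist_eq, lt_min_iff, lt_min_iff, abs_lt, abs_lt, abs_lt] at hx
    exact ⟨by linarith, by linarith, by linarith⟩
  have hne : ∀ᵐ τ : ℝ, τ ≠ t := by simp [ae_iff]
  have hL : ∀ᵐ τ, τ ∈ Metric.ball t (min δ₁ (min δ₂ δ₃)) → τ + s < t → τ ∈ G → τ + s ∉ F := by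
    rcases h2 with h2 | h2
    · filter_upwards [h2] with τ hτ h4 h5 h6
      exact absurd (hτ ⟨(hb _ h4).2.1, by linarith⟩) (hnot _ h6)
    · filter_upwards [ae_shift s h2] with τ hτ h4 h5 h6
      exact hτ ⟨by linarith [(hb _ h4).2.1], h5⟩
  have hR : ∀ᵐ τ, τ ∈ Metric.ball t (min δ₁ (min δ₂ δ₃)) →
      τ + s ∈ Metric.ball t (min δ₁ (min δ₂ δ₃)) → t < τ + s → τ ∈ G → τ + s ∉ F := by
    rcases h1 with h1 | h1
    · rcases h3 with h3 | h3
      · refine absurd ⟨min δ₁ δ₃, lt_min hδ₁ hδ₃, ?_, ?_⟩ hc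
        · filter_upwards [h1] with τ h4 h5
          exact h4 ⟨h5.1, h5.2.trans_le (by linarith [min_le_left δ₁ δ₃])⟩
        · filter_upwards [h3] with τ h4 h5
          exact h4 ⟨lt_of_le_of_lt (by linarith [min_le_right δ₁ δ₃]) h5.1, h5.2⟩
      · filter_upwards [h1, h3, hne] with τ h4 h5 h6 h7 h8 h9 h10
        rcases lt_or_gt_of_ne h6 with h11 | h11
        · exact absurd h10 (h5 ⟨(hb _ h7).2.2, h11⟩)
        · exact absurd (h4 ⟨h11, (hb _ h7).1⟩) (hnot _ h10)
    · filter_upwards [ae_shift s h1] with τ h4 h5 h6 h7 h8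
      exact h4 ⟨h7, (hb _ h6).1⟩
  filter_upwards [hL, hR, ae_shift s hne] with τ h4 h5 h6 h7 h8 h9
  rcases lt_or_gt_of_ne h6 with h | h
  · exact h4 h7 h h9
  · exact h5 h7 h8 h h9

/-- Without contact points, short translations do not move `G` into `F`. -/
theorem eventually_measure_cross_eq_zero {F G : Set ℝ} (hF : MeasurableSet F)
    (hG : MeasurableSet G) (hFG : Disjoint F G) {M : ℝ≥0∞} (hM : M ≠ ⊤)
    (hFM : ∀ n, volume (jumpSet F (dyadic n)) ≤ M * ENNReal.ofReal (dyadic n))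
    (hGM : ∀ n, volume (jumpSet G (dyadic n)) ≤ M * ENNReal.ofReal (dyadic n))
    (hc : ∀ t, ¬ Contact F G t) :
    ∀ᶠ n in atTop, volume {τ | τ ∈ G ∧ τ + dyadic n ∈ F} = 0 := by
  have hnot : ∀ x, x ∈ G → x ∉ F := fun x hx hx' => Set.disjoint_left.1 hFG hx' hx
  choose δ hδ hloc using fun t => exists_nhd_ae_not_cross hF hG hFG hM hFM hGM (hc t)
  obtain ⟨R₁, h1⟩ := exists_top_ae_const hF hM hFM
  obtain ⟨R₂, h2⟩ := exists_bot_ae_const hF hM hFM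
  obtain ⟨ε, hε, hcov⟩ := lebesgue_number_lemma_of_metric (s := Set.Icc (-R₂ - 1) R₁)
    isCompact_Icc (fun t => Metric.isOpen_ball (x := t) (ε := δ t))
    (fun t _ => Set.mem_iUnion.2 ⟨t, Metric.mem_ball_self (hδ t)⟩)
  filter_upwards [tendsto_dyadic.eventually (gt_mem_nhds (half_pos hε)),
    tendsto_dyadic.eventually (gt_mem_nhds one_pos)] with n hn hn1
  have hs := dyadic_pos n
  set s := dyadic n
  have hmid : volume {τ | τ ∈ Set.Icc (-R₂ - 1) R₁ ∧ τ ∈ G ∧ τ + s ∈ F} = 0 := by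
    refine measure_null_of_locally_null _ fun x hx => ?_
    obtain ⟨i, hi⟩ := hcov x hx.1
    refine ⟨{τ | τ ∈ Set.Icc (-R₂ - 1) R₁ ∧ τ ∈ G ∧ τ + s ∈ F} ∩ Metric.ball x (ε / 2),
      inter_mem self_mem_nhdsWithin (mem_nhdsWithin_of_mem_nhds
        (Metric.ball_mem_nhds x (half_pos hε))), ?_⟩
    rw [measure_eq_zero_iff_ae_notMem]
    filter_upwards [hloc i s hs] with τ h3
    rintro ⟨⟨h4, h5, h6⟩, h7⟩
    rw [Metric.mem_ball, Real.dist_eq, abs_lt] at h7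
    refine h3 (hi ?_) (hi ?_) h5 h6 <;>
    · rw [Metric.mem_ball, Real.dist_eq, abs_lt]; constructor <;> linarith
  have htop : ∀ᵐ τ, R₁ < τ → τ ∈ G → τ + s ∉ F := by
    rcases h1 with h1 | h1
    · filter_upwards [h1] with τ h3 h4 h5
      exact absurd (h3 h4) (hnot _ h5)
    · filter_upwards [ae_shift s h1] with τ h3 h4 h5
      exact h3 (by rw [Set.mem_Ioi]; linarith)
  have hbot : ∀ᵐ τ, τ + s < -R₂ → τ ∈ G → τ + s ∉ F := by
    rcases h2 with h2 | h2
    · filter_upwards [h2] with τ h3 h4 h5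
      exact absurd (h3 (by rw [Set.mem_Iio]; linarith)) (hnot _ h5)
    · filter_upwards [ae_shift s h2] with τ h3 h4 h5
      exact h3 h4
  rw [measure_eq_zero_iff_ae_notMem] at hmid ⊢
  filter_upwards [hmid, htop, hbot] with τ h3 h4 h5
  rintro ⟨h6, h7⟩
  by_cases h8 : R₁ < τ
  · exact h4 h8 h6 h7
  · by_cases h9 : τ + s < -R₂
    · exact h5 h9 h6 h7
    · exact h3 ⟨⟨by linarith, by linarith⟩, h6, h7⟩

/-- `S` has density zero at `x` with respect to `μ`. -/
def ZeroDensity {X : Type*} [PseudoMetricSpace X] [MeasurableSpace X] (μ : Measure X) (S : Set X)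
    (x : X) : Prop :=
  Tendsto (fun r : ℝ => μ (S ∩ Metric.ball x r) / μ (Metric.ball x r))
    (nhdsWithin 0 (Set.Ioi 0)) (nhds 0)

theorem ZeroDensity.preimage {X Y : Type*}
    [NormedAddCommGroup X] [NormedSpace ℝ X] [FiniteDimensional ℝ X] [MeasurableSpace X]
    [BorelSpace X] [NormedAddCommGroup Y] [NormedSpace ℝ Y] [FiniteDimensional ℝ Y]
    [MeasurableSpace Y] [BorelSpace Y] (T : X ≃L[ℝ] Y)
    (μ : Measure X) [μ.IsAddHaarMeasure] (ν : Measure Y) [ν.IsAddHaarMeasure]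
    {S : Set Y} {x : X} (h : ZeroDensity ν S (T x)) :
    ZeroDensity μ (T ⁻¹' S) x := by
  have : (μ.map T).IsAddHaarMeasure := T.isAddHaarMeasure_map μ
  obtain ⟨c, hc⟩ : ∃ c : NNReal, μ.map T = c • ν :=
    ⟨_, Measure.isAddLeftInvariant_eq_smul (μ.map T) ν⟩
  set K : ℝ := ‖(T : X →L[ℝ] Y)‖ + 1 with hK
  have hK0 : 0 < K := by positivity
  set n := Module.finrank ℝ X
  have hn : Module.finrank ℝ Y = n := T.toLinearEquiv.finrank_eq.symm
  set ωX := μ (Metric.ball 0 1)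
  set ωY := ν (Metric.ball 0 1)
  have hωX : ωX ≠ 0 := (Metric.measure_ball_pos μ 0 one_pos).ne'
  have hωX' : ωX ≠ ⊤ := measure_ball_lt_top.ne
  have hωY : ωY ≠ 0 := (Metric.measure_ball_pos ν 0 one_pos).ne'
  have hωY' : ωY ≠ ⊤ := measure_ball_lt_top.ne
  set C : ℝ≥0∞ := c * (ENNReal.ofReal (K ^ n) * ωY / ωX) with hC
  have hCtop : C ≠ ⊤ := ENNReal.mul_ne_top ENNReal.coe_ne_top
    (ENNReal.div_ne_top (ENNReal.mul_ne_top ENNReal.ofReal_ne_top hωY') hωX)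
  have hlim : Tendsto (fun r : ℝ => K * r) (nhdsWithin 0 (Set.Ioi 0))
      (nhdsWithin 0 (Set.Ioi 0)) := by
    refine tendsto_nhdsWithin_iff.2 ⟨?_, ?_⟩
    · have : Tendsto (fun r : ℝ => K * r) (nhds 0) (nhds (K * 0)) := tendsto_id.const_mul K
      rw [mul_zero] at this
      exact this.mono_left nhdsWithin_le_nhds
    · filter_upwards [self_mem_nhdsWithin] with r hr using mul_pos hK0 hr
  have h2 := ENNReal.Tendsto.const_mul (a := C) (h.comp hlim) (Or.inr hCtop)
  rw [mul_zero] at h2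
  refine tendsto_of_tendsto_of_tendsto_of_le_of_le' tendsto_const_nhds h2
    (Eventually.of_forall fun _ => zero_le) ?_
  filter_upwards [self_mem_nhdsWithin] with r (hr : 0 < r)
  have hsub : μ (T ⁻¹' S ∩ Metric.ball x r) ≤ c * ν (S ∩ Metric.ball (T x) (K * r)) := by
    have hm : μ (T ⁻¹' (S ∩ Metric.ball (T x) (K * r)))
        = c * ν (S ∩ Metric.ball (T x) (K * r)) := by
      have h3 := (T.toHomeomorph.toMeasurableEquiv).map_apply (μ := μ)
        (S ∩ Metric.ball (T x) (K * r))
      have h4 : μ.map T.toHomeomorph.toMeasurableEquiv = c • ν := hc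
      rw [h4] at h3
      exact h3.symm
    rw [← hm]
    refine measure_mono fun z hz => ⟨hz.1, ?_⟩
    have h5 : dist z x < r := hz.2
    rw [Metric.mem_ball, dist_eq_norm, ← map_sub]
    calc ‖T (z - x)‖ ≤ ‖(T : X →L[ℝ] Y)‖ * ‖z - x‖ := (T : X →L[ℝ] Y).le_opNorm _
      _ ≤ K * ‖z - x‖ := by gcongr; linarith
      _ < K * r := by rw [← dist_eq_norm]; gcongr
  have hbX : μ (Metric.ball x r) = ENNReal.ofReal (r ^ n) * ωX := Measure.addHaar_ball_of_pos μ x hr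
  have hbY : ν (Metric.ball (T x) (K * r)) = ENNReal.ofReal (r ^ n) * (ENNReal.ofReal (K ^ n) * ωY)
      := by
    rw [Measure.addHaar_ball_of_pos ν (T x) (mul_pos hK0 hr), hn, mul_pow, mul_comm (K ^ n),
      ENNReal.ofReal_mul (by positivity), mul_assoc]
  have hr0 : ENNReal.ofReal (r ^ n) ≠ 0 := by
    rw [Ne, ENNReal.ofReal_eq_zero, not_le]; positivity
  have hKn : ENNReal.ofReal (K ^ n) ≠ 0 := by
    rw [Ne, ENNReal.ofReal_eq_zero, not_le]; positivity
  simp only [Function.comp]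
  calc μ (T ⁻¹' S ∩ Metric.ball x r) / μ (Metric.ball x r)
      ≤ c * ν (S ∩ Metric.ball (T x) (K * r)) / μ (Metric.ball x r) := by gcongr
    _ = C * (ν (S ∩ Metric.ball (T x) (K * r)) / ν (Metric.ball (T x) (K * r))) := by
        set V := ν (S ∩ Metric.ball (T x) (K * r))
        have hW0 : ENNReal.ofReal (K ^ n) * ωY ≠ 0 := mul_ne_zero hKn hωY
        have hW1 : ENNReal.ofReal (K ^ n) * ωY ≠ ⊤ := ENNReal.mul_ne_top ENNReal.ofReal_ne_top hωY'
        rw [hbX, hbY, hC]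
        set W := ENNReal.ofReal (K ^ n) * ωY
        simp only [div_eq_mul_inv]
        rw [ENNReal.mul_inv (Or.inl hr0) (Or.inl ENNReal.ofReal_ne_top),
          ENNReal.mul_inv (Or.inl hr0) (Or.inl ENNReal.ofReal_ne_top)]
        calc _ = (W * W⁻¹) * (c * V * ((ENNReal.ofReal (r ^ n))⁻¹ * ωX⁻¹)) := by
              rw [ENNReal.mul_inv_cancel hW0 hW1, one_mul]
          _ = _ := by ring

variable {H : Type*} [NormedAddCommGroup H] [NormedSpace ℝ H] [FiniteDimensional ℝ H]
  [MeasurableSpace H] [BorelSpace H] (μ : Measure H) [μ.IsAddHaarMeasure]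

omit [BorelSpace H] in
theorem prod_ball (t r : ℝ) (y : H) :
    (volume.prod μ) (Metric.ball (t, y) r) = ENNReal.ofReal (2 * r) * μ (Metric.ball y r) := by
  rw [← ball_prod_same, Measure.prod_prod, Real.volume_ball]

theorem measure_eq_zero_of_rightFilled_of_sparse {F : Set (ℝ × H)} (hF : MeasurableSet F)
    {c δ ρ : ℝ} (hδ : 0 < δ) (hρ : 0 < ρ) {W : Set H}
    (hW : ∀ y ∈ W, ∃ t ∈ Set.Ico c (c + δ / 2),
      (∀ᵐ τ, τ ∈ Set.Ioo t (t + δ) → (τ, y) ∈ F) ∧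
      ∀ r ∈ Set.Ioo 0 ρ, (volume.prod μ) (F ∩ Metric.ball (t, y) r) ≤
        ENNReal.ofReal (1 / (32 * 4 ^ Module.finrank ℝ H)) *
          (volume.prod μ) (Metric.ball (t, y) r)) : μ W = 0 := by
  by_contra hW0
  have hne : (ae (μ.restrict W)).NeBot := by
    rw [ae_neBot]; simpa [Measure.restrict_eq_zero] using hW0
  obtain ⟨z, hz⟩ := (Besicovitch.ae_tendsto_measure_inter_div μ W).exists
  have hhalf : (1 / 2 : ℝ≥0∞) < 1 := by simp
  obtain ⟨r, hr1, hr2, hr0⟩ := ((hz.eventually (lt_mem_nhds hhalf)).and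
    (Ioo_mem_nhdsGT (lt_min (half_pos hδ) (show 0 < ρ / 3 by positivity)))).exists
  rw [lt_min_iff] at hr0
  have hcB0 : μ (Metric.closedBall z r) ≠ 0 := (Metric.measure_closedBall_pos μ z hr2).ne'
  have hcBt : μ (Metric.closedBall z r) ≠ ⊤ := measure_closedBall_lt_top.ne
  rw [ENNReal.lt_div_iff_mul_lt (Or.inl hcB0) (Or.inl hcBt)] at hr1
  choose! t htI htF htS using hW
  set B := W ∩ Metric.closedBall z r with hB
  have hBne : B.Nonempty := by
    by_contra h
    rw [Set.not_nonempty_iff_eq_empty] at h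
    rw [h] at hr1
    simp at hr1
  have hbdd : BddAbove (t '' B) := ⟨c + δ / 2, by
    rintro _ ⟨y, hy, rfl⟩; exact (htI y hy.1).2.le⟩
  obtain ⟨_, ⟨y₀, hy₀, rfl⟩, hsup⟩ := exists_lt_of_lt_csSup (hBne.image t)
    (show sSup (t '' B) - r / 2 < sSup (t '' B) by linarith)
  have htle : ∀ y ∈ B, t y < t y₀ + r / 2 := fun y hy => by
    linarith [le_csSup hbdd (Set.mem_image_of_mem t hy)]
  set J : Set ℝ := Set.Ioo (t y₀ + r / 2) (t y₀ + r) with hJ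
  set P : Set (ℝ × H) := F ∩ J ×ˢ Metric.closedBall z r with hP
  have hPm : MeasurableSet P := hF.inter (measurableSet_Ioo.prod measurableSet_closedBall)
  have hPball : P ⊆ F ∩ Metric.ball (t y₀, y₀) (3 * r) := by
    rintro ⟨τ, y⟩ ⟨h1, h2, h3⟩
    refine ⟨h1, ?_⟩
    rw [← ball_prod_same]
    refine ⟨?_, ?_⟩
    · simp only [hJ, Set.mem_Ioo] at h2
      rw [Metric.mem_ball, Real.dist_eq, abs_lt]; constructor <;> linarith
    · have h4 := hy₀.2
      rw [Metric.mem_closedBall] at h3 h4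
      rw [Metric.mem_ball]
      linarith [dist_triangle_right y y₀ z]
  have hlow : ENNReal.ofReal (r / 2) * μ B ≤ (volume.prod μ) P := by
    rw [Measure.prod_apply_symm hPm]
    refine le_trans ?_ (mul_meas_ge_le_lintegral (measurable_measure_prodMk_right hPm)
      (ENNReal.ofReal (r / 2)))
    refine mul_le_mul' le_rfl (measure_mono ?_)
    intro y hy
    have hJsub : ∀ᵐ τ, τ ∈ J → τ ∈ (fun x => (x, y)) ⁻¹' P := by
      filter_upwards [htF y hy.1] with τ h1 h2
      refine ⟨h1 ⟨?_, ?_⟩, h2, hy.2⟩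
      · linarith [htle y hy, h2.1]
      · linarith [(htI y hy.1).1, (htI y₀ hy₀.1).2, h2.2]
    calc ENNReal.ofReal (r / 2) = volume J := by
          rw [hJ, Real.volume_Ioo]; congr 1; ring
      _ ≤ _ := measure_mono_ae hJsub
  have hup := hlow.trans ((measure_mono hPball).trans
    (htS y₀ hy₀.1 (3 * r) ⟨by linarith, by linarith⟩))
  set n := Module.finrank ℝ H
  set m := (μ (Metric.closedBall z r)).toReal with hm
  have hmpos : 0 < m := ENNReal.toReal_pos hcB0 hcBt
  have hmeq : μ (Metric.closedBall z r) = ENNReal.ofReal m := (ENNReal.ofReal_toReal hcBt).symm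
  have hball : μ (Metric.ball y₀ (3 * r)) ≤ ENNReal.ofReal (4 ^ n * m) := by
    calc μ (Metric.ball y₀ (3 * r)) ≤ μ (Metric.closedBall z (4 * r)) := by
          refine measure_mono fun y hy => ?_
          have h4 := hy₀.2
          rw [Metric.mem_closedBall] at h4 ⊢
          rw [Metric.mem_ball] at hy
          linarith [dist_triangle y y₀ z]
      _ = ENNReal.ofReal (4 ^ n * m) := by
          rw [ENNReal.ofReal_mul (by positivity), ← hmeq,
            Measure.addHaar_closedBall μ z (show 0 ≤ 4 * r by linarith),
            Measure.addHaar_closedBall μ z hr2.le, mul_pow, ENNReal.ofReal_mul (by positivity),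
            mul_assoc]
  have hfin : ENNReal.ofReal (r / 2 * (1 / 2 * m)) ≤
      ENNReal.ofReal (1 / (32 * 4 ^ n) * (2 * (3 * r) * (4 ^ n * m))) := by
    calc ENNReal.ofReal (r / 2 * (1 / 2 * m))
        = ENNReal.ofReal (r / 2) * (1 / 2 * μ (Metric.closedBall z r)) := by
          rw [ENNReal.ofReal_mul (by positivity), ENNReal.ofReal_mul (by positivity), hmeq]
          simp
      _ ≤ ENNReal.ofReal (r / 2) * μ B := by gcongr
      _ ≤ _ := hup
      _ = ENNReal.ofReal (1 / (32 * 4 ^ n)) *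
          (ENNReal.ofReal (2 * (3 * r)) * μ (Metric.ball y₀ (3 * r))) := by rw [prod_ball]
      _ ≤ ENNReal.ofReal (1 / (32 * 4 ^ n)) *
          (ENNReal.ofReal (2 * (3 * r)) * ENNReal.ofReal (4 ^ n * m)) := by gcongr
      _ = _ := by
          rw [← ENNReal.ofReal_mul (by positivity), ← ENNReal.ofReal_mul (by positivity)]
  rw [ENNReal.ofReal_le_ofReal_iff (by positivity)] at hfin
  have h4n : (0 : ℝ) < 4 ^ n := by positivity
  have : 1 / (32 * 4 ^ n) * (2 * (3 * r) * (4 ^ n * m)) = 6 / 32 * (r * m) := by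
    field_simp; ring
  rw [this] at hfin
  nlinarith [mul_pos hr2 hmpos]

theorem measure_eq_zero_of_filled {E : Set (ℝ × H)} (hE : MeasurableSet E)
    {c δ : ℝ} (hδ : 0 < δ) {W : Set H}
    (hW : ∀ y ∈ W, ∃ t ∈ Set.Ico c (c + δ / 2),
      (∀ᵐ τ, τ ∈ Set.Ioo (t - δ) (t + δ) → (τ, y) ∈ E) ∧
      ¬ ZeroDensity (volume.prod μ) Eᶜ (t, y)) : μ W = 0 := by
  have hdens := Besicovitch.ae_tendsto_measure_inter_div μ W
  rw [ae_iff] at hdens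
  refine measure_mono_null (t := {y | ¬ Tendsto
      (fun r => μ (W ∩ Metric.closedBall y r) / μ (Metric.closedBall y r))
      (nhdsWithin 0 (Set.Ioi 0)) (nhds 1)} ∩ W) (fun y hy => ⟨?_, hy⟩)
    (le_antisymm ((Measure.le_restrict_apply W _).trans hdens.le) zero_le)
  intro hlim
  obtain ⟨t₀, ht₀, -, hnot⟩ := hW y hy
  refine hnot ?_
  choose! t htI htE _ using hW
  have hlim2 := ENNReal.Tendsto.sub (tendsto_const_nhds (x := (1 : ℝ≥0∞))) hlim
    (Or.inl ENNReal.one_ne_top)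
  rw [tsub_self] at hlim2
  refine tendsto_of_tendsto_of_tendsto_of_le_of_le' tendsto_const_nhds hlim2
    (Eventually.of_forall fun _ => zero_le) ?_
  filter_upwards [Ioo_mem_nhdsGT (half_pos hδ)] with r ⟨hr0, hr⟩
  set J : Set ℝ := Set.Ioo (t₀ - r) (t₀ + r) with hJ
  set P : Set (ℝ × H) := Eᶜ ∩ J ×ˢ Metric.closedBall y r with hP
  have hPm : MeasurableSet P := hE.compl.inter (measurableSet_Ioo.prod measurableSet_closedBall)
  set f : H → ℝ≥0∞ := fun z => volume ((fun x => (x, z)) ⁻¹' P) with hf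
  have hfm : Measurable f := measurable_measure_prodMk_right hPm
  set S : Set H := f ⁻¹' {0} with hS
  have hSm : MeasurableSet S := hfm (measurableSet_singleton 0)
  have hWS : W ⊆ S := by
    intro z hz
    simp only [hS, hf, Set.mem_preimage, Set.mem_singleton_iff]
    rw [measure_eq_zero_iff_ae_notMem]
    filter_upwards [htE z hz] with τ h1
    rintro ⟨h2, h3, -⟩
    refine h2 (h1 ⟨?_, ?_⟩)
    · linarith [(htI z hz).2, ht₀.1, h3.1]
    · linarith [(htI z hz).1, ht₀.2, h3.2]
  have hcB0 : μ (Metric.closedBall y r) ≠ 0 := (Metric.measure_closedBall_pos μ y hr0).ne'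
  have hcBt : μ (Metric.closedBall y r) ≠ ⊤ := measure_closedBall_lt_top.ne
  have hPle : (volume.prod μ) P ≤ ENNReal.ofReal (2 * r) * μ (Metric.closedBall y r \ S) := by
    rw [Measure.prod_apply_symm hPm, ← setLIntegral_const]
    rw [← lintegral_indicator (measurableSet_closedBall.diff hSm)]
    refine lintegral_mono fun z => ?_
    by_cases hz : z ∈ Metric.closedBall y r \ S
    · rw [Set.indicator_of_mem hz]
      calc volume ((fun x => (x, z)) ⁻¹' P) ≤ volume J := measure_mono fun τ h => h.2.1
        _ = ENNReal.ofReal (2 * r) := by rw [hJ, Real.volume_Ioo]; congr 1; ring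
    · rw [Set.indicator_of_notMem hz]
      by_cases hzS : z ∈ S
      · exact le_of_eq hzS
      · have : (fun x => (x, z)) ⁻¹' P = ∅ := by
          ext τ
          simp only [Set.mem_preimage, Set.mem_empty_iff_false, iff_false]
          exact fun h => hz ⟨h.2.2, hzS⟩
        simp [this]
  have hdiff : μ (Metric.closedBall y r \ S) ≤
      μ (Metric.closedBall y r) - μ (W ∩ Metric.closedBall y r) := by
    refine ENNReal.le_sub_of_add_le_left
      ((measure_mono Set.inter_subset_right).trans_lt hcBt.lt_top).ne ?_
    calc μ (W ∩ Metric.closedBall y r) + μ (Metric.closedBall y r \ S)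
        ≤ μ (Metric.closedBall y r ∩ S) + μ (Metric.closedBall y r \ S) :=
          add_le_add (measure_mono fun z hz => ⟨hz.2, hWS hz.1⟩) le_rfl
      _ = _ := measure_inter_add_sdiff _ hSm
  have h2r : ENNReal.ofReal (2 * r) ≠ 0 := by
    rw [Ne, ENNReal.ofReal_eq_zero, not_le]; linarith
  calc (volume.prod μ) (Eᶜ ∩ Metric.ball (t₀, y) r) / (volume.prod μ) (Metric.ball (t₀, y) r)
      ≤ (volume.prod μ) P / (volume.prod μ) (Metric.ball (t₀, y) r) := by
        gcongr
        rintro ⟨τ, z⟩ ⟨h1, h2⟩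
        rw [← ball_prod_same] at h2
        refine ⟨h1, ?_, Metric.ball_subset_closedBall h2.2⟩
        rw [hJ, ← Real.ball_eq_Ioo]; exact h2.1
    _ ≤ ENNReal.ofReal (2 * r) * (μ (Metric.closedBall y r) - μ (W ∩ Metric.closedBall y r)) /
        (ENNReal.ofReal (2 * r) * μ (Metric.closedBall y r)) := by
        have hcb : μ (Metric.closedBall y r) = μ (Metric.ball y r) := by
          rw [Measure.addHaar_closedBall μ y hr0.le, Measure.addHaar_ball_of_pos μ y hr0]
        rw [prod_ball, ← hcb]
        exact ENNReal.div_le_div_right (hPle.trans (mul_le_mul' le_rfl hdiff)) _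
    _ = (μ (Metric.closedBall y r) - μ (W ∩ Metric.closedBall y r)) /
        μ (Metric.closedBall y r) := ENNReal.mul_div_mul_left _ _ h2r ENNReal.ofReal_ne_top
    _ = _ := by
        rw [ENNReal.sub_div (fun _ _ => hcB0), ENNReal.div_self hcB0 hcBt]

theorem exists_nat_grid {δ : ℝ} (hδ : 0 < δ) (t : ℝ) :
    ∃ k : ℕ, ∃ j : ℤ, (1 / (k + 1) : ℝ) ≤ δ ∧
      t ∈ Set.Ico (j * (1 / (k + 1) / 2) : ℝ) (j * (1 / (k + 1) / 2) + 1 / (k + 1) / 2) := by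
  obtain ⟨k, hk⟩ := exists_nat_one_div_lt hδ
  have hp : (0 : ℝ) < 1 / (k + 1) / 2 := by positivity
  refine ⟨k, ⌊t / (1 / (k + 1) / 2)⌋, hk.le, ?_, ?_⟩
  · rw [← le_div_iff₀ hp]; exact Int.floor_le _
  · have := Int.lt_floor_add_one (t / (1 / (k + 1 : ℝ) / 2))
    rw [div_lt_iff₀ hp] at this
    linarith

/-- On almost every line, no point with `F` filling its right side has `F` of density zero. -/
theorem measure_contact_zeroDensity {F G : Set (ℝ × H)} (hF : MeasurableSet F) :
    μ {y | ∃ t, Contact {τ | (τ, y) ∈ F} {τ | (τ, y) ∈ G} t ∧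
      ZeroDensity (volume.prod μ) F (t, y)} = 0 := by
  set ε : ℝ≥0∞ := ENNReal.ofReal (1 / (32 * 4 ^ Module.finrank ℝ H)) with hε
  have hε0 : 0 < ε := by rw [hε, ENNReal.ofReal_pos]; positivity
  set W : ℕ × ℤ × ℕ → Set H := fun p => {y | ∃ t ∈ Set.Ico (p.2.1 * (1 / (p.1 + 1) / 2) : ℝ)
      (p.2.1 * (1 / (p.1 + 1) / 2) + 1 / (p.1 + 1) / 2),
      (∀ᵐ τ, τ ∈ Set.Ioo t (t + 1 / (p.1 + 1)) → (τ, y) ∈ F) ∧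
      ∀ r ∈ Set.Ioo (0 : ℝ) (1 / (p.2.2 + 1)), (volume.prod μ) (F ∩ Metric.ball (t, y) r) ≤
        ε * (volume.prod μ) (Metric.ball (t, y) r)} with hW
  have hnull : ∀ p, μ (W p) = 0 := fun p =>
    measure_eq_zero_of_rightFilled_of_sparse μ hF (c := p.2.1 * (1 / (p.1 + 1) / 2))
      (δ := 1 / (p.1 + 1)) (ρ := 1 / (p.2.2 + 1)) (by positivity) (by positivity) fun y hy => hy
  refine measure_mono_null ?_ (measure_iUnion_null hnull)
  rintro y ⟨t, ⟨δ, hδ, hcF, -⟩, hz⟩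
  obtain ⟨k, j, hk, hj⟩ := exists_nat_grid hδ t
  obtain ⟨ρ, hρ, hsub⟩ := mem_nhdsGT_iff_exists_Ioo_subset.1 (hz.eventually (gt_mem_nhds hε0))
  obtain ⟨m, hm⟩ := exists_nat_one_div_lt (show (0 : ℝ) < ρ from hρ)
  refine Set.mem_iUnion.2 ⟨(k, j, m), t, hj, ?_, ?_⟩
  · filter_upwards [hcF] with τ h1 h2 using h1 ⟨h2.1, h2.2.trans_le (by linarith)⟩
  · intro r hr
    have h1 := hsub (show r ∈ Set.Ioo 0 ρ from ⟨hr.1, hr.2.trans hm⟩)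
    have h1' : (volume.prod μ) (F ∩ Metric.ball (t, y) r) /
      (volume.prod μ) (Metric.ball (t, y) r) < ε := h1
    have hb0 : (volume.prod μ) (Metric.ball (t, y) r) ≠ 0 :=
      (Metric.measure_ball_pos _ _ hr.1).ne'
    have hbt : (volume.prod μ) (Metric.ball (t, y) r) ≠ ⊤ := measure_ball_lt_top.ne
    exact (ENNReal.div_le_iff hb0 hbt).1 h1'.le

/-- On almost every line, `E` has density one wherever it fills both sides of a point. -/
theorem measure_contact_not_density_one {E F G : Set (ℝ × H)} (hE : MeasurableSet E)
    (hF : F ⊆ E) (hG : G ⊆ E) :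
    μ {y | ∃ t, Contact {τ | (τ, y) ∈ F} {τ | (τ, y) ∈ G} t ∧
      ¬ ZeroDensity (volume.prod μ) Eᶜ (t, y)} = 0 := by
  set W : ℕ × ℤ → Set H := fun p => {y | ∃ t ∈ Set.Ico (p.2 * (1 / (p.1 + 1) / 2) : ℝ)
      (p.2 * (1 / (p.1 + 1) / 2) + 1 / (p.1 + 1) / 2),
      (∀ᵐ τ, τ ∈ Set.Ioo (t - 1 / (p.1 + 1)) (t + 1 / (p.1 + 1)) → (τ, y) ∈ E) ∧
      ¬ ZeroDensity (volume.prod μ) Eᶜ (t, y)} with hW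
  have hnull : ∀ p, μ (W p) = 0 := fun p =>
    measure_eq_zero_of_filled μ hE (c := p.2 * (1 / (p.1 + 1) / 2))
      (δ := 1 / (p.1 + 1)) (by positivity) fun y hy => hy
  refine measure_mono_null ?_ (measure_iUnion_null hnull)
  rintro y ⟨t, ⟨δ, hδ, hcF, hcG⟩, hz⟩
  obtain ⟨k, j, hk, hj⟩ := exists_nat_grid hδ t
  refine Set.mem_iUnion.2 ⟨(k, j), t, hj, ?_, hz⟩
  have hne : ∀ᵐ τ : ℝ, τ ≠ t := by simp [ae_iff]
  filter_upwards [hcF, hcG, hne] with τ h1 h2 h3 h4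
  rcases lt_or_gt_of_ne h3 with h | h
  · exact hG (h2 ⟨by linarith [h4.1], h⟩)
  · exact hF (h1 ⟨h, by linarith [h4.2]⟩)

theorem measure_contact_zeroDensity_left {F G : Set (ℝ × H)} (hG : MeasurableSet G) :
    μ {y | ∃ t, Contact {τ | (τ, y) ∈ F} {τ | (τ, y) ∈ G} t ∧
      ZeroDensity (volume.prod μ) G (t, y)} = 0 := by
  set N : (ℝ × H) ≃L[ℝ] (ℝ × H) := (ContinuousLinearEquiv.neg ℝ).prodCongr
    (ContinuousLinearEquiv.refl ℝ H) with hN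
  have hNa : ∀ t y, N (t, y) = (-t, y) := fun t y => rfl
  refine measure_mono_null ?_ (measure_contact_zeroDensity μ (F := N ⁻¹' G) (G := N ⁻¹' F)
    (hG.preimage N.continuous.measurable))
  rintro y ⟨t, ⟨δ, hδ, hcF, hcG⟩, hz⟩
  have hq := (Measure.measurePreserving_neg (volume : Measure ℝ)).quasiMeasurePreserving
  refine ⟨-t, ⟨δ, hδ, ?_, ?_⟩, ?_⟩
  · filter_upwards [hq.ae hcG] with τ h1 h2
    exact h1 ⟨by linarith [h2.2], by linarith [h2.1]⟩
  · filter_upwards [hq.ae hcF] with τ h1 h2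
    exact h1 ⟨by linarith [h2.2], by linarith [h2.1]⟩
  · refine ZeroDensity.preimage N _ (volume.prod μ) ?_
    rwa [hNa, neg_neg]

theorem dyadic_eq_add (n : ℕ) : dyadic n = dyadic (n + 1) + dyadic (n + 1) := by
  unfold dyadic; rw [pow_succ]; ring

theorem volume_jumpSet_add_le (A : Set ℝ) (s r : ℝ) :
    volume (jumpSet A (s + r)) ≤ volume (jumpSet A s) + volume (jumpSet A r) := by
  have hsub : jumpSet A (s + r) ⊆ jumpSet A s ∪ (fun t => t + s) ⁻¹' jumpSet A r := by
    intro t ht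
    simp only [jumpSet, Set.mem_ofPred_eq, Set.mem_union, Set.mem_preimage, ← add_assoc] at ht ⊢
    tauto
  calc _ ≤ volume (jumpSet A s ∪ (fun t => t + s) ⁻¹' jumpSet A r) := measure_mono hsub
    _ ≤ volume (jumpSet A s) + volume ((fun t => t + s) ⁻¹' jumpSet A r) := measure_union_le _ _
    _ = _ := by rw [measure_preimage_add_right]

theorem monotone_volume_jumpSet_div (A : Set ℝ) :
    Monotone fun n => volume (jumpSet A (dyadic n)) / ENNReal.ofReal (dyadic n) := by
  refine monotone_nat_of_le_succ fun n => ?_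
  have h2 : ENNReal.ofReal (dyadic n) = 2 * ENNReal.ofReal (dyadic (n + 1)) := by
    rw [dyadic_eq_add n, ENNReal.ofReal_add (dyadic_pos _).le (dyadic_pos _).le, two_mul]
  have h1 : volume (jumpSet A (dyadic n)) ≤ 2 * volume (jumpSet A (dyadic (n + 1))) := by
    rw [dyadic_eq_add n, two_mul]; exact volume_jumpSet_add_le A _ _
  calc _ ≤ 2 * volume (jumpSet A (dyadic (n + 1))) / ENNReal.ofReal (dyadic n) := by gcongr
    _ = _ := by rw [h2, ENNReal.mul_div_mul_left _ _ (by simp) (by simp)]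

section Slices

variable {H : Type*} [NormedAddCommGroup H] [NormedSpace ℝ H] [FiniteDimensional ℝ H]
  [MeasurableSpace H] [BorelSpace H] (μ : Measure H) [μ.IsAddHaarMeasure]

theorem lintegral_iSup_volume_jumpSet_div_le {F : Set (ℝ × H)} (hF : MeasurableSet F) {C : ℝ≥0∞}
    (hC : ∀ n, (volume.prod μ) (jumpSet F (dyadic n, 0)) ≤ C * ENNReal.ofReal (dyadic n)) :
    ∫⁻ y, ⨆ n, volume (jumpSet {τ | (τ, y) ∈ F} (dyadic n)) / ENNReal.ofReal (dyadic n) ∂μ ≤ C ∧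
    ∀ n, Measurable fun y =>
      volume (jumpSet {τ | (τ, y) ∈ F} (dyadic n)) / ENNReal.ofReal (dyadic n) := by
  have hs : ∀ n y, jumpSet {τ | (τ, y) ∈ F} (dyadic n)
      = (fun τ => (τ, y)) ⁻¹' jumpSet F (dyadic n, 0) := by
    intro n y; ext τ; simp [jumpSet]
  have hmeas : ∀ n, Measurable fun y =>
      volume (jumpSet {τ | (τ, y) ∈ F} (dyadic n)) / ENNReal.ofReal (dyadic n) := by
    intro n
    simp_rw [hs]
    exact (measurable_measure_prodMk_right (measurableSet_jumpSet hF _)).div_const _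
  refine ⟨?_, hmeas⟩
  rw [lintegral_iSup hmeas fun m n hmn y => monotone_volume_jumpSet_div _ hmn]

  refine iSup_le fun n => ?_
  have hp : ENNReal.ofReal (dyadic n) ≠ 0 := by simpa using dyadic_pos n
  simp_rw [hs, div_eq_mul_inv]
  rw [lintegral_mul_const _ (measurable_measure_prodMk_right (measurableSet_jumpSet hF _)),
    ← Measure.prod_apply_symm (measurableSet_jumpSet hF _), ← div_eq_mul_inv]
  exact ENNReal.div_le_of_le_mul (hC n)

/-- If on almost every line `F` and `G` have no contact point, then the amount of mass jumping
from `G` to `F` in a short translation is of lower order. -/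
theorem tendsto_prod_cross_div {F G : Set (ℝ × H)} (hF : MeasurableSet F) (hG : MeasurableSet G)
    (hFG : Disjoint F G) {C : ℝ≥0∞} (hCt : C ≠ ⊤)
    (hFC : ∀ n, (volume.prod μ) (jumpSet F (dyadic n, 0)) ≤ C * ENNReal.ofReal (dyadic n))
    (hGC : ∀ n, (volume.prod μ) (jumpSet G (dyadic n, 0)) ≤ C * ENNReal.ofReal (dyadic n))
    (hc : μ {y | ∃ t, Contact {τ | (τ, y) ∈ F} {τ | (τ, y) ∈ G} t} = 0) :
    Tendsto (fun n => (volume.prod μ) {x | x ∈ G ∧ x + (dyadic n, 0) ∈ F} /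
      ENNReal.ofReal (dyadic n)) atTop (nhds 0) := by
  obtain ⟨hFi, hFm⟩ := lintegral_iSup_volume_jumpSet_div_le μ hF hFC
  obtain ⟨hGi, hGm⟩ := lintegral_iSup_volume_jumpSet_div_le μ hG hGC
  have hFae := ae_lt_top (Measurable.iSup hFm) (hFi.trans_lt hCt.lt_top).ne
  have hGae := ae_lt_top (Measurable.iSup hGm) (hGi.trans_lt hCt.lt_top).ne
  have hp : ∀ n, ENNReal.ofReal (dyadic n) ≠ 0 := fun n => by simpa using dyadic_pos n
  have hm : ∀ n, MeasurableSet {x : ℝ × H | x ∈ G ∧ x + (dyadic n, 0) ∈ F} := fun n =>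
    hG.inter (hF.preimage (measurable_add_const _))
  have hs : ∀ n y, (fun τ => (τ, y)) ⁻¹' {x : ℝ × H | x ∈ G ∧ x + (dyadic n, 0) ∈ F}
      = {τ | τ ∈ {τ | (τ, y) ∈ G} ∧ τ + dyadic n ∈ {τ | (τ, y) ∈ F}} := by
    intro n y; ext τ; simp
  have heq : ∀ n, (volume.prod μ) {x | x ∈ G ∧ x + (dyadic n, 0) ∈ F} /
      ENNReal.ofReal (dyadic n) = ∫⁻ y, volume {τ | τ ∈ {τ | (τ, y) ∈ G} ∧
        τ + dyadic n ∈ {τ | (τ, y) ∈ F}} / ENNReal.ofReal (dyadic n) ∂μ := by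
    intro n
    simp_rw [← hs, div_eq_mul_inv]
    rw [lintegral_mul_const _ (measurable_measure_prodMk_right (hm n)),
      ← Measure.prod_apply_symm (hm n)]
  simp_rw [heq]
  have hlim := tendsto_lintegral_of_dominated_convergence (μ := μ) (f := fun _ => 0)
    (F := fun n y => volume {τ | τ ∈ {τ | (τ, y) ∈ G} ∧
        τ + dyadic n ∈ {τ | (τ, y) ∈ F}} / ENNReal.ofReal (dyadic n))
    (fun y => ⨆ n, volume (jumpSet {τ | (τ, y) ∈ F} (dyadic n)) / ENNReal.ofReal (dyadic n))
    (fun n => by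
      simp_rw [← hs]
      exact (measurable_measure_prodMk_right (hm n)).div_const _)
    (fun n => Eventually.of_forall fun y => by
      refine le_trans ?_ (le_iSup (fun n => volume (jumpSet {τ | (τ, y) ∈ F} (dyadic n)) /
        ENNReal.ofReal (dyadic n)) n)
      refine ENNReal.div_le_div_right (measure_mono fun τ hτ => ?_) _
      have : τ ∉ {τ | (τ, y) ∈ F} := fun h => Set.disjoint_left.1 hFG h hτ.1
      simp only [jumpSet, Set.mem_ofPred_eq] at this hτ ⊢
      tauto)
    (hFi.trans_lt hCt.lt_top).ne ?_
  · simpa using hlim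
  · filter_upwards [hFae, hGae, measure_eq_zero_iff_ae_notMem.1 hc] with y h1 h2 h3
    have hle : ∀ (A : Set (ℝ × H)) (n : ℕ), volume (jumpSet {τ | (τ, y) ∈ A} (dyadic n)) ≤
        (⨆ n, volume (jumpSet {τ | (τ, y) ∈ A} (dyadic n)) / ENNReal.ofReal (dyadic n)) *
          ENNReal.ofReal (dyadic n) := fun A n => by
      rw [← ENNReal.div_le_iff (hp n) ENNReal.ofReal_ne_top]
      exact le_iSup (fun n => volume (jumpSet {τ | (τ, y) ∈ A} (dyadic n)) /
        ENNReal.ofReal (dyadic n)) n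
    have hev := eventually_measure_cross_eq_zero (F := {τ | (τ, y) ∈ F}) (G := {τ | (τ, y) ∈ G})
      (hF.preimage measurable_prodMk_right) (hG.preimage measurable_prodMk_right)
      (Set.disjoint_left.2 fun τ hτ hτ' => Set.disjoint_left.1 hFG hτ hτ')
      (max_lt h1 h2).ne
      (fun n => (hle F n).trans (mul_le_mul' (le_max_left _ _) le_rfl))
      (fun n => (hle G n).trans (mul_le_mul' (le_max_right _ _) le_rfl))
      (fun t ht => h3 ⟨t, ht⟩)
    refine tendsto_const_nhds.congr' ?_
    filter_upwards [hev] with n hn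
    rw [hn, ENNReal.zero_div]

end Slices

theorem exists_lineCoord {V : Type*} [NormedAddCommGroup V] [InnerProductSpace ℝ V]
    [FiniteDimensional ℝ V] {v : V} (hv : v ≠ 0) :
    ∃ T : (ℝ × (Submodule.span ℝ {v})ᗮ) ≃L[ℝ] V, ∀ p, T p = p.1 • v + p.2 := by
  refine ⟨(((LinearEquiv.toSpanNonzeroSingleton ℝ V v hv).prodCongr (LinearEquiv.refl ℝ _)) ≪≫ₗ
    Submodule.prodEquivOfIsCompl _ _ (Submodule.isCompl_orthogonal
      (K := Submodule.span ℝ {v}))).toContinuousLinearEquiv, fun p => ?_⟩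
  simp

theorem ZeroDensity.mono {X : Type*} [PseudoMetricSpace X] [MeasurableSpace X] {μ : Measure X}
    {S S' : Set X} {x : X} (h : ZeroDensity μ S' x) (hS : S ⊆ S') : ZeroDensity μ S x :=
  tendsto_of_tendsto_of_tendsto_of_le_of_le tendsto_const_nhds h (fun _ => zero_le)
    fun _ => ENNReal.div_le_div_right (measure_mono (Set.inter_subset_inter_left _ hS)) _

theorem densityPt_one_iff {d : ℕ} {E : Set (Ed d)} (hE : MeasurableSet E) (x : Ed d) :
    densityPt E 1 x ↔ ZeroDensity volume Eᶜ x := by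
  have hsum : ∀ r > 0, volume (E ∩ Metric.ball x r) / volume (Metric.ball x r) +
      volume (Eᶜ ∩ Metric.ball x r) / volume (Metric.ball x r) = 1 := by
    intro r hr
    rw [← ENNReal.add_div, Set.inter_comm E, Set.inter_comm Eᶜ, ← Set.sdiff_eq,
      measure_inter_add_sdiff _ hE]
    exact ENNReal.div_self (Metric.measure_ball_pos _ _ hr).ne' measure_ball_lt_top.ne
  have hle : ∀ (A : Set (Ed d)) (r : ℝ), volume (A ∩ Metric.ball x r) / volume (Metric.ball x r)
      ≠ ⊤ := fun A r => (lt_of_le_of_lt (ENNReal.div_le_of_le_mul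
        (by rw [one_mul]; exact measure_mono Set.inter_subset_right)) ENNReal.one_lt_top).ne
  constructor
  · intro h
    have h2 := ENNReal.Tendsto.sub (tendsto_const_nhds (x := (1 : ℝ≥0∞))) h
      (Or.inl ENNReal.one_ne_top)
    rw [tsub_self] at h2
    refine h2.congr' ?_
    filter_upwards [self_mem_nhdsWithin] with r hr
    rw [← hsum r hr, ENNReal.add_sub_cancel_left (hle E r)]
  · intro h
    have h2 := ENNReal.Tendsto.sub (tendsto_const_nhds (x := (1 : ℝ≥0∞))) h
      (Or.inl ENNReal.one_ne_top)
    rw [tsub_zero] at h2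
    refine h2.congr' ?_
    filter_upwards [self_mem_nhdsWithin] with r hr
    rw [← hsum r hr, ENNReal.add_sub_cancel_right (hle Eᶜ r)]

/-- If the essential boundary of `F ⊆ E` is `H^{d-1}`-negligible in the measure-theoretic interior
of `E`, then the mass jumping from `E \ F` to `F` in a translation by `s • v` is `o(s)`. -/
theorem tendsto_cross_div {d : ℕ} {E F : Set (Ed d)} (hFE : F ⊆ E) (hE : MeasurableSet E)
    (hF : MeasurableSet F) (v : Ed d) {C : ℝ≥0∞} (hC : C ≠ ⊤)
    (hFC : ∀ n, volume (jumpSet F (dyadic n • v)) ≤ C * ENNReal.ofReal (dyadic n))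
    (hGC : ∀ n, volume (jumpSet (E \ F) (dyadic n • v)) ≤ C * ENNReal.ofReal (dyadic n))
    (h0 : Measure.hausdorffMeasure ((d : ℝ) - 1) (essBoundary F ∩ densitySet E 1) = 0) :
    Tendsto (fun n => volume {x | x ∈ E \ F ∧ x + dyadic n • v ∈ F} /
      ENNReal.ofReal (dyadic n)) atTop (nhds 0) := by
  rcases eq_or_ne v 0 with rfl | hv
  · have : ∀ n, {x | x ∈ E \ F ∧ x + dyadic n • (0 : Ed d) ∈ F} = ∅ := by
      intro n
      rw [Set.eq_empty_iff_forall_notMem]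
      rintro x ⟨h1, h2⟩
      rw [smul_zero, add_zero] at h2
      exact h1.2 h2
    simp only [this, measure_empty, ENNReal.zero_div]
    exact tendsto_const_nhds
  obtain ⟨H, hH, T, hT⟩ : ∃ H : Submodule ℝ (Ed d), H = (Submodule.span ℝ {v})ᗮ ∧
      ∃ T : (ℝ × H) ≃L[ℝ] Ed d, ∀ p, T p = p.1 • v + (p.2 : Ed d) :=
    ⟨_, rfl, exists_lineCoord hv⟩
  have hfin : ((Module.finrank ℝ H : ℕ) : ℝ) = (d : ℝ) - 1 := by
    have h1 := Submodule.finrank_add_finrank_orthogonal (Submodule.span ℝ {v})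
    rw [finrank_span_singleton hv, finrank_euclideanSpace_fin, ← hH] at h1
    have h2 : ((1 + Module.finrank ℝ H : ℕ) : ℝ) = d := congrArg _ h1
    push_cast at h2
    linarith
  set μ : Measure H := Measure.hausdorffMeasure (Module.finrank ℝ H) with hμ
  have hμH : μ.IsAddHaarMeasure := isAddHaarMeasure_hausdorffMeasure
  have hmap : ((volume.prod μ).map T).IsAddHaarMeasure := T.isAddHaarMeasure_map _
  obtain ⟨c, hc⟩ : ∃ c : NNReal, (volume.prod μ).map T = c • (volume : Measure (Ed d)) :=
    ⟨_, Measure.isAddLeftInvariant_eq_smul _ _⟩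
  have hcS : ∀ S, (volume.prod μ) (T ⁻¹' S) = c * volume S := by
    intro S
    have h3 := (T.toHomeomorph.toMeasurableEquiv).map_apply (μ := volume.prod μ) S
    have h4 : (volume.prod μ).map T.toHomeomorph.toMeasurableEquiv = c • volume := hc
    rw [h4] at h3
    exact h3.symm
  have hc0 : c ≠ 0 := by
    rintro rfl
    have := hcS Set.univ
    simp at this
  have hjump : ∀ (A : Set (Ed d)) (n : ℕ), jumpSet (T ⁻¹' A) (dyadic n, 0)
      = T ⁻¹' jumpSet A (dyadic n • v) := by
    intro A n; ext p
    have : T (dyadic n, 0) = dyadic n • v := by simp [hT]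
    simp [jumpSet, map_add, this]
  have hTm : Measurable T := T.continuous.measurable
  have key := tendsto_prod_cross_div μ (F := T ⁻¹' F) (G := T ⁻¹' (E \ F)) (hF.preimage hTm)
    ((hE.diff hF).preimage hTm) (Set.disjoint_left.2 fun x hx hx' => hx'.2 hx)
    (C := c * C) (ENNReal.mul_ne_top ENNReal.coe_ne_top hC)
    (fun n => by rw [hjump, hcS, mul_assoc]; exact mul_le_mul' le_rfl (hFC n))
    (fun n => by rw [hjump, hcS, mul_assoc]; exact mul_le_mul' le_rfl (hGC n)) ?_
  · have hcross : ∀ n, {x | x ∈ T ⁻¹' (E \ F) ∧ x + (dyadic n, 0) ∈ T ⁻¹' F}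
        = T ⁻¹' {x | x ∈ E \ F ∧ x + dyadic n • v ∈ F} := by
      intro n; ext p
      have : T (dyadic n, 0) = dyadic n • v := by simp [hT]
      simp [map_add, this]
    simp_rw [hcross, hcS] at key
    have h2 := ENNReal.Tendsto.const_mul (a := (c : ℝ≥0∞)⁻¹) key
      (Or.inr (ENNReal.inv_ne_top.2 (by simpa using hc0)))
    rw [mul_zero] at h2
    refine h2.congr fun n => ?_
    rw [mul_div_assoc, ← mul_assoc, ENNReal.inv_mul_cancel (by simpa using hc0)
      ENNReal.coe_ne_top, one_mul]
  · have hN : μ ((fun x => (T.symm x).2) '' (essBoundary F ∩ densitySet E 1)) = 0 := by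
      have hL := ((ContinuousLinearMap.snd ℝ ℝ H).comp
        (T.symm : Ed d →L[ℝ] ℝ × H)).lipschitz
      refine le_antisymm ((hL.hausdorffMeasure_image_le (Nat.cast_nonneg _) _).trans ?_) zero_le
      rw [hfin, h0, mul_zero]
    refine measure_mono_null ?_ (measure_union_null (measure_union_null (measure_union_null hN
      (measure_contact_zeroDensity μ (F := T ⁻¹' F) (G := T ⁻¹' (E \ F)) (hF.preimage hTm)))
      (measure_contact_zeroDensity_left μ (F := T ⁻¹' F) (G := T ⁻¹' (E \ F))
        ((hE.diff hF).preimage hTm)))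
      (measure_contact_not_density_one μ (F := T ⁻¹' F) (G := T ⁻¹' (E \ F)) (E := T ⁻¹' E)
        (hE.preimage hTm) (Set.preimage_mono hFE) (Set.preimage_mono Set.sdiff_subset)))
    rintro y ⟨t, ht⟩
    by_cases h1 : ZeroDensity (volume.prod μ) (T ⁻¹' E)ᶜ (t, y)
    swap
    · exact Or.inr ⟨t, ht, h1⟩
    left
    by_cases h2 : ZeroDensity (volume.prod μ) (T ⁻¹' F) (t, y)
    · exact Or.inl (Or.inr ⟨t, ht, h2⟩)
    by_cases h3 : ZeroDensity (volume.prod μ) (T ⁻¹' (E \ F)) (t, y)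
    · exact Or.inr ⟨t, ht, h3⟩
    refine Or.inl (Or.inl ⟨T (t, y), ⟨?_, ?_⟩, by simp⟩)
    · rintro (h4 | h4)
      · exact h2 (ZeroDensity.preimage T (volume.prod μ) volume h4)
      · exact h3 (ZeroDensity.preimage T (volume.prod μ) volume
          (((densityPt_one_iff hF _).1 h4).mono fun x hx => hx.2))
    · refine (densityPt_one_iff hE _).2 ?_
      have h5 : ZeroDensity (volume.prod μ) (T ⁻¹' E)ᶜ (T.symm (T (t, y))) := by simpa using h1
      have h6 := ZeroDensity.preimage T.symm volume (volume.prod μ) h5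
      have h7 : T.symm ⁻¹' (T ⁻¹' E)ᶜ = Eᶜ := by ext x; simp
      rwa [h7] at h6

/-- The mean of `|⟨·, v⟩|` over the unit ball does not depend on the direction. -/
theorem exists_lintegral_ball_enorm_apply (d : ℕ) :
    ∃ κ : ℝ≥0∞, κ ≠ 0 ∧ κ ≠ ⊤ ∧ ∀ L : Ed d →L[ℝ] ℝ,
      ∫⁻ v in Metric.ball 0 1, ‖L v‖ₑ = κ * ‖L‖ₑ := by
  rcases Nat.eq_zero_or_pos d with rfl | hd
  · refine ⟨1, one_ne_zero, ENNReal.one_ne_top, fun L => ?_⟩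
    have : L = 0 := Subsingleton.elim _ _
    simp [this, ← ofReal_norm]
  set e : Ed d := EuclideanSpace.single ⟨0, hd⟩ 1 with he
  have he1 : ‖e‖ = 1 := by simp [he]
  refine ⟨∫⁻ v in Metric.ball 0 1, ‖inner ℝ e v‖ₑ, ?_, ?_, fun L => ?_⟩
  · intro h
    have hmeas : Measurable fun v : Ed d => ‖inner ℝ e v‖ₑ := by fun_prop
    rw [lintegral_eq_zero_iff hmeas, EventuallyEq, ae_restrict_iff' measurableSet_ball] at h
    have hopen : IsOpen (Metric.ball (0 : Ed d) 1 ∩ {v | inner ℝ e v ≠ 0}) := by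
      refine Metric.isOpen_ball.inter (isOpen_ne_fun (by fun_prop) continuous_const)
    refine (hopen.measure_pos (volume : Measure (Ed d)) ⟨(1 / 2 : ℝ) • e, ?_, ?_⟩).ne' ?_
    · rw [mem_ball_zero_iff, norm_smul, he1]; norm_num
    · simp [inner_smul_right, he1]
    · rw [measure_eq_zero_iff_ae_notMem]
      filter_upwards [h] with v hv
      rintro ⟨h1, h2⟩
      exact h2 (by simpa using hv h1)
  · refine ((setLIntegral_mono (g := fun _ => 1) measurable_const fun v hv => ?_).trans_lt ?_).ne
    · rw [← ofReal_norm, ENNReal.ofReal_le_one]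
      refine (norm_inner_le_norm e v).trans ?_
      rw [he1, one_mul]; exact (mem_ball_zero_iff.1 hv).le
    · simpa using measure_ball_lt_top
  · set g := (InnerProductSpace.toDual ℝ (Ed d)).symm L with hg
    have hLg : ∀ v, L v = inner ℝ g v := fun v => by
      rw [hg, InnerProductSpace.toDual_symm_apply]
    have hn : ‖L‖ = ‖g‖ := by rw [hg, LinearIsometryEquiv.norm_map]
    have hnb : ‖‖g‖ • e‖ = ‖g‖ := by rw [norm_smul, he1, mul_one, norm_norm]
    set R := (Submodule.span ℝ {‖g‖ • e - g})ᗮ.reflection with hR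
    have hRg : R (‖g‖ • e) = g := Submodule.reflection_sub hnb
    have h1 : ∀ v, ‖L (R v)‖ₑ = ‖L‖ₑ * ‖inner ℝ e v‖ₑ := by
      intro v
      rw [hLg]
      nth_rewrite 1 [← hRg]
      rw [LinearIsometryEquiv.inner_map_map, inner_smul_left, enorm_mul]
      congr 1
      rw [← enorm_norm L, hn]
      simp
    have hmp : MeasurePreserving R volume volume := R.measurePreserving
    have hpre : R ⁻¹' Metric.ball 0 1 = Metric.ball 0 1 := by
      ext v; simp
    calc ∫⁻ v in Metric.ball 0 1, ‖L v‖ₑ = ∫⁻ v in R ⁻¹' Metric.ball 0 1, ‖L (R v)‖ₑ := by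
          rw [hmp.setLIntegral_comp_preimage (f := fun v => ‖L v‖ₑ) measurableSet_ball
            (by fun_prop)]
      _ = ∫⁻ v in Metric.ball 0 1, ‖L‖ₑ * ‖inner ℝ e v‖ₑ := by rw [hpre]; simp_rw [h1]
      _ = _ := by
          rw [lintegral_const_mul _ (by fun_prop), mul_comm]

/-- The convolution of `u` with a normalized bump function. -/
def mollify {d : ℕ} (φ : ContDiffBump (0 : Ed d)) (u : Ed d → ℝ) : Ed d → ℝ :=
  convolution (φ.normed volume) u (ContinuousLinearMap.lsmul ℝ ℝ) volume

theorem mollify_apply {d : ℕ} (φ : ContDiffBump (0 : Ed d)) (u : Ed d → ℝ) (x : Ed d) :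
    mollify φ u x = ∫ t, φ.normed volume t * u (x - t) := rfl

section Mollify

variable {d : ℕ} (φ : ContDiffBump (0 : Ed d)) {u : Ed d → ℝ}

theorem locallyIntegrable_of_norm_le_one {X V : Type*} [TopologicalSpace X] [MeasurableSpace X]
    [NormedAddCommGroup V] {μ : Measure X} [IsLocallyFiniteMeasure μ] {u : X → V}
    (hu : AEStronglyMeasurable u μ) (hu1 : ∀ x, ‖u x‖ ≤ 1) : LocallyIntegrable u μ :=
  (locallyIntegrable_const (1 : ℝ)).mono hu (Eventually.of_forall fun x => by simpa using hu1 x)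

theorem lintegral_enorm_normed : ∫⁻ t, ‖φ.normed volume t‖ₑ = 1 := by
  have h1 : ∀ t, ‖φ.normed volume t‖ₑ = ENNReal.ofReal (φ.normed volume t) := fun t =>
    Real.enorm_of_nonneg (φ.nonneg_normed t)
  simp_rw [h1]
  rw [← ofReal_integral_eq_lintegral_ofReal φ.integrable_normed
    (Eventually.of_forall φ.nonneg_normed), φ.integral_normed, ENNReal.ofReal_one]

theorem contDiff_mollify (hu : Measurable u) (hu1 : ∀ x, ‖u x‖ ≤ 1) {n : ℕ∞} :
    ContDiff ℝ n (mollify φ u) :=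
  φ.hasCompactSupport_normed.contDiff_convolution_left _ φ.contDiff_normed
    (locallyIntegrable_of_norm_le_one hu.aestronglyMeasurable hu1)

theorem norm_convolution_normed_le_one {V : Type*} [NormedAddCommGroup V] [NormedSpace ℝ V]
    {w : Ed d → V} (hw1 : ∀ x, ‖w x‖ ≤ 1) (x : Ed d) :
    ‖convolution (φ.normed volume) w (ContinuousLinearMap.lsmul ℝ ℝ) volume x‖ ≤ 1 := by
  calc _ ≤ ∫ t, φ.normed volume t := by
        refine norm_integral_le_of_norm_le φ.integrable_normed (Eventually.of_forall fun t => ?_)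
        rw [ContinuousLinearMap.lsmul_apply, norm_smul, Real.norm_of_nonneg (φ.nonneg_normed t)]
        exact mul_le_of_le_one_right (φ.nonneg_normed t) (hw1 _)
    _ = 1 := φ.integral_normed

theorem integrable_normed_mul (hu : Measurable u) (hu1 : ∀ x, ‖u x‖ ≤ 1) (x : Ed d) :
    Integrable fun t => φ.normed volume t * u (x - t) :=
  (φ.integrable_normed (μ := volume)).mul_bdd (c := 1)
    (hu.comp (measurable_const_sub x)).aestronglyMeasurable
    (Eventually.of_forall fun _ => hu1 _)

/-- Mollification does not increase `L¹` moduli of continuity. -/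
theorem lintegral_enorm_mollify_sub_le (hu : Measurable u) (hu1 : ∀ x, ‖u x‖ ≤ 1) (h : Ed d) :
    ∫⁻ x, ‖mollify φ u (x + h) - mollify φ u x‖ₑ ≤ ∫⁻ x, ‖u (x + h) - u x‖ₑ := by
  have hρ : Measurable (φ.normed volume) := φ.continuous_normed.measurable
  calc ∫⁻ x, ‖mollify φ u (x + h) - mollify φ u x‖ₑ
      ≤ ∫⁻ x, ∫⁻ t, ‖φ.normed volume t‖ₑ * ‖u (x - t + h) - u (x - t)‖ₑ := by
        refine lintegral_mono fun x => ?_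
        rw [mollify_apply, mollify_apply, ← integral_sub (integrable_normed_mul φ hu hu1 _)
          (integrable_normed_mul φ hu hu1 _)]
        refine (enorm_integral_le_lintegral_enorm _).trans (le_of_eq ?_)
        congr 1; ext t
        rw [← mul_sub, enorm_mul, sub_add_eq_add_sub]
    _ = ∫⁻ t, ∫⁻ x, ‖φ.normed volume t‖ₑ * ‖u (x - t + h) - u (x - t)‖ₑ := by
        refine lintegral_lintegral_swap (Measurable.aemeasurable ?_)
        fun_prop
    _ = ∫⁻ t, ‖φ.normed volume t‖ₑ * ∫⁻ x, ‖u (x + h) - u x‖ₑ := by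
        congr 1; ext t
        rw [lintegral_const_mul _ (by fun_prop)]
        congr 1
        exact lintegral_sub_right_eq_self (fun x => ‖u (x + h) - u x‖ₑ) t
    _ = _ := by
        rw [lintegral_mul_const _ (by fun_prop), lintegral_enorm_normed, one_mul]

theorem lintegral_enorm_indicator_sub {A : Set (Ed d)} (hA : MeasurableSet A) (h : Ed d) :
    ∫⁻ x, ‖A.indicator (fun _ => (1 : ℝ)) (x + h) - A.indicator (fun _ => (1 : ℝ)) x‖ₑ
      = volume (jumpSet A h) := by
  rw [← lintegral_indicator_one (measurableSet_jumpSet hA h)]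
  congr 1; ext x
  by_cases h1 : x ∈ A <;> by_cases h2 : x + h ∈ A <;> simp [jumpSet, Set.indicator, h1, h2]

theorem measurable_indicator_one {A : Set (Ed d)} (hA : MeasurableSet A) :
    Measurable (A.indicator fun _ => (1 : ℝ)) := measurable_const.indicator hA

theorem norm_indicator_one_le (A : Set (Ed d)) (x : Ed d) :
    ‖A.indicator (fun _ => (1 : ℝ)) x‖ ≤ 1 := by
  by_cases h : x ∈ A <;> simp [h]

/-- `L¹` norms of directional derivatives of mollifications are controlled by difference
quotients. -/
theorem lintegral_fderiv_mollify_le_liminf (hu : Measurable u) (hu1 : ∀ x, ‖u x‖ ≤ 1)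
    (v : Ed d) : ∫⁻ x, ‖fderiv ℝ (mollify φ u) x v‖ₑ ≤ liminf (fun k =>
      (∫⁻ x, ‖u (x + dyadic k • v) - u x‖ₑ) / ENNReal.ofReal (dyadic k)) atTop := by
  have hsm : ContDiff ℝ 1 (mollify φ u) := contDiff_mollify φ hu hu1 (n := 1)
  have hlim : ∀ x, Tendsto (fun k => ‖(dyadic k)⁻¹ •
      (mollify φ u (x + dyadic k • v) - mollify φ u x)‖ₑ) atTop
      (nhds ‖fderiv ℝ (mollify φ u) x v‖ₑ) := by
    intro x
    have hd : HasFDerivAt (mollify φ u) (fderiv ℝ (mollify φ u) x) x :=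
      (hsm.differentiable one_ne_zero).differentiableAt.hasFDerivAt
    have hl := (hd.hasLineDerivAt v).tendsto_slope_zero_right
    exact (hl.comp tendsto_dyadic_pos).enorm
  calc ∫⁻ x, ‖fderiv ℝ (mollify φ u) x v‖ₑ
      = ∫⁻ x, liminf (fun k => ‖(dyadic k)⁻¹ •
        (mollify φ u (x + dyadic k • v) - mollify φ u x)‖ₑ) atTop := by
        congr 1; ext x; exact (hlim x).liminf_eq.symm
    _ ≤ liminf (fun k => ∫⁻ x, ‖(dyadic k)⁻¹ •
        (mollify φ u (x + dyadic k • v) - mollify φ u x)‖ₑ) atTop := by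
        refine lintegral_liminf_le fun k => ?_
        have := hsm.continuous
        exact Continuous.measurable (by fun_prop)
    _ ≤ _ := by
        refine liminf_le_liminf (Eventually.of_forall fun k => ?_)
        have h1 : ‖(dyadic k)⁻¹‖ₑ = (ENNReal.ofReal (dyadic k))⁻¹ := by
          rw [Real.enorm_of_nonneg (inv_nonneg.2 (dyadic_pos k).le),
            ENNReal.ofReal_inv_of_pos (dyadic_pos k)]
        simp_rw [enorm_smul, h1]
        rw [lintegral_const_mul' _ _ (by simpa using dyadic_pos k), mul_comm,
          ← div_eq_mul_inv]
        exact ENNReal.div_le_div_right (lintegral_enorm_mollify_sub_le φ hu hu1 _) _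

theorem lintegral_enorm_sub_le_fderiv {w : Ed d → ℝ} (hw : ContDiff ℝ 1 w) (v : Ed d) {s : ℝ}
    (hs : 0 ≤ s) : ∫⁻ x, ‖w (x + s • v) - w x‖ₑ ≤
      ENNReal.ofReal s * ∫⁻ x, ‖fderiv ℝ w x v‖ₑ := by
  have hc : Continuous fun x => fderiv ℝ w x v :=
    (hw.continuous_fderiv one_ne_zero).clm_apply continuous_const
  calc ∫⁻ x, ‖w (x + s • v) - w x‖ₑ
      ≤ ∫⁻ x, ∫⁻ τ in Set.Ioc 0 s, ‖fderiv ℝ w (x + τ • v) v‖ₑ := by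
        refine lintegral_mono fun x => ?_
        have hder : ∀ τ : ℝ, HasDerivAt (fun τ : ℝ => w (x + τ • v))
            (fderiv ℝ w (x + τ • v) v) τ := by
          intro τ
          have h1 : HasFDerivAt w (fderiv ℝ w (x + τ • v)) (x + τ • v) :=
            (hw.differentiable one_ne_zero).differentiableAt.hasFDerivAt
          have h2 : HasDerivAt (fun τ : ℝ => x + τ • v) v τ := by
            simpa using ((hasDerivAt_id τ).smul_const v).const_add x
          exact h1.comp_hasDerivAt τ h2
        have hF := intervalIntegral.integral_eq_sub_of_hasDerivAt (a := 0) (b := s)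
          (fun τ _ => hder τ) (Continuous.intervalIntegrable
            (hc.comp (by fun_prop : Continuous fun τ : ℝ => x + τ • v)) _ _)
        rw [zero_smul, add_zero] at hF
        rw [← hF, intervalIntegral.integral_of_le hs]
        exact enorm_integral_le_lintegral_enorm _
    _ = ∫⁻ τ in Set.Ioc 0 s, ∫⁻ x, ‖fderiv ℝ w (x + τ • v) v‖ₑ := by
        refine lintegral_lintegral_swap (Measurable.aemeasurable ?_)
        exact ((hc.comp (by fun_prop : Continuous fun p : Ed d × ℝ => p.1 + p.2 • v)).enorm
          ).measurable
    _ = ∫⁻ τ in Set.Ioc 0 s, ∫⁻ x, ‖fderiv ℝ w x v‖ₑ := by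
        congr 1; ext τ
        exact lintegral_add_right_eq_self (fun x => ‖fderiv ℝ w x v‖ₑ) (τ • v)
    _ = _ := by
        rw [setLIntegral_const, Real.volume_Ioc, sub_zero, mul_comm]

theorem lintegral_enorm_sub_le_liminf {u : Ed d → ℝ} (v : Ed d) {s : ℝ}
    (hs : 0 ≤ s) {w : ℕ → Ed d → ℝ} (hw : ∀ n, ContDiff ℝ 1 (w n))
    (hlim : ∀ᵐ x, Tendsto (fun n => w n x) atTop (nhds (u x))) :
    ∫⁻ x, ‖u (x + s • v) - u x‖ₑ ≤
      ENNReal.ofReal s * liminf (fun n => ∫⁻ x, ‖fderiv ℝ (w n) x v‖ₑ) atTop := by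
  have hlim' : ∀ᵐ x, Tendsto (fun n => w n (x + s • v)) atTop (nhds (u (x + s • v))) :=
    (measurePreserving_add_right volume (s • v)).quasiMeasurePreserving.ae hlim
  calc ∫⁻ x, ‖u (x + s • v) - u x‖ₑ
      = ∫⁻ x, liminf (fun n => ‖w n (x + s • v) - w n x‖ₑ) atTop := by
        refine lintegral_congr_ae ?_
        filter_upwards [hlim, hlim'] with x h1 h2
        exact (h2.sub h1).enorm.liminf_eq.symm
    _ ≤ liminf (fun n => ∫⁻ x, ‖w n (x + s • v) - w n x‖ₑ) atTop := by
        refine lintegral_liminf_le fun n => ?_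
        have := (hw n).continuous
        exact Continuous.measurable (by fun_prop)
    _ ≤ liminf (fun n => ENNReal.ofReal s * ∫⁻ x, ‖fderiv ℝ (w n) x v‖ₑ) atTop :=
        liminf_le_liminf (Eventually.of_forall fun n => lintegral_enorm_sub_le_fderiv (hw n) v hs)
    _ = _ := ENNReal.liminf_const_mul_of_ne_top ENNReal.ofReal_ne_top

end Mollify

section Divergence

variable {d : ℕ}

theorem clm_apply_eq_sum (L : Ed d →L[ℝ] ℝ) (a : Ed d) :
    L a = ∑ i, L (EuclideanSpace.single i 1) * a i := by
  have h : a = ∑ i, a i • EuclideanSpace.single i (1 : ℝ) := by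
    ext j; simp [Finset.sum_apply, Pi.single_apply]
  conv_lhs => rw [h]
  simp [mul_comm]

theorem fderiv_coord {φ : Ed d → Ed d} {x : Ed d} (hφ : DifferentiableAt ℝ φ x) (i : Fin d)
    (a : Ed d) : fderiv ℝ (fun y => φ y i) x a = fderiv ℝ φ x a i := by
  have h := ((EuclideanSpace.proj i : Ed d →L[ℝ] ℝ).hasFDerivAt.comp x hφ.hasFDerivAt).fderiv
  exact congrArg (fun L => L a) h

theorem continuous_vdiv {φ : Ed d → Ed d} (hφ : ContDiff ℝ 1 φ) : Continuous (vdiv φ) := by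
  refine continuous_finsetSum _ fun i _ => ?_
  exact (EuclideanSpace.proj i : Ed d →L[ℝ] ℝ).continuous.comp
    ((hφ.continuous_fderiv one_ne_zero).clm_apply continuous_const)

theorem hasCompactSupport_vdiv {φ : Ed d → Ed d} (hφ : HasCompactSupport φ) :
    HasCompactSupport (vdiv φ) := by
  refine (hφ.fderiv (𝕜 := ℝ)).mono fun x hx h => hx ?_
  simp [vdiv, h]

theorem integral_mul_vdiv {w : Ed d → ℝ} (hw : ContDiff ℝ 1 w) {φ : Ed d → Ed d}
    (hφ : ContDiff ℝ 1 φ) (hc : HasCompactSupport φ) :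
    ∫ x, w x * vdiv φ x = - ∫ x, fderiv ℝ w x (φ x) := by
  have hwc := hw.continuous
  have hφi : ∀ i, ContDiff ℝ 1 fun y => φ y i := fun i =>
    (EuclideanSpace.proj i : Ed d →L[ℝ] ℝ).contDiff.comp hφ
  have hci : ∀ i, HasCompactSupport fun y => φ y i := fun i =>
    hc.mono fun x hx h => hx (by simp [h])
  have hdc : ∀ i, Continuous fun x => fderiv ℝ w x (EuclideanSpace.single i 1) := fun i =>
    (hw.continuous_fderiv one_ne_zero).clm_apply continuous_const
  have hdφ : ∀ i, Continuous fun x =>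
      fderiv ℝ (fun y => φ y i) x (EuclideanSpace.single i 1) := fun i =>
    ((hφi i).continuous_fderiv one_ne_zero).clm_apply continuous_const
  have hint1 : ∀ i, Integrable fun x =>
      w x * fderiv ℝ (fun y => φ y i) x (EuclideanSpace.single i 1) := fun i =>
    (hwc.mul (hdφ i)).integrable_of_hasCompactSupport
      (((hci i).fderiv_apply (𝕜 := ℝ) _).mul_left)
  have hint2 : ∀ i, Integrable fun x =>
      fderiv ℝ w x (EuclideanSpace.single i 1) * φ x i := fun i =>
    ((hdc i).mul (hφi i).continuous).integrable_of_hasCompactSupport (hci i).mul_left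
  calc ∫ x, w x * vdiv φ x
      = ∫ x, ∑ i, w x * fderiv ℝ (fun y => φ y i) x (EuclideanSpace.single i 1) := by
        congr 1; ext x
        rw [vdiv, Finset.mul_sum]
        refine Finset.sum_congr rfl fun i _ => ?_
        rw [fderiv_coord (hφ.differentiable one_ne_zero).differentiableAt]
    _ = ∑ i, - ∫ x, fderiv ℝ w x (EuclideanSpace.single i 1) * φ x i := by
        rw [integral_finsetSum _ fun i _ => hint1 i]
        refine Finset.sum_congr rfl fun i _ => ?_
        refine integral_mul_fderiv_eq_neg_fderiv_mul_of_integrable (hint2 i) (hint1 i)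
          ((hwc.mul (hφi i).continuous).integrable_of_hasCompactSupport (hci i).mul_left)
          (fun x _ => (hw.differentiable one_ne_zero).differentiableAt)
          (fun x _ => ((hφi i).differentiable one_ne_zero).differentiableAt)
    _ = _ := by
        rw [Finset.sum_neg_distrib, ← integral_finsetSum _ fun i _ => hint2 i]
        congr 2; ext x
        exact (clm_apply_eq_sum _ _).symm

/-- Lower semicontinuity of the variation along an a.e. convergent sequence of smooth functions. -/
theorem variation_le_liminf {u : Ed d → ℝ} {w : ℕ → Ed d → ℝ} (hw : ∀ n, ContDiff ℝ 1 (w n))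
    (hw1 : ∀ n x, ‖w n x‖ ≤ 1)
    (hlim : ∀ᵐ x, Tendsto (fun n => w n x) atTop (nhds (u x))) :
    variation u ≤ liminf (fun n => ∫⁻ x, ‖fderiv ℝ (w n) x‖ₑ) atTop := by
  refine iSup_le ?_
  rintro ⟨φ, hφ, hc, -, hφ1⟩
  have hφ' : ContDiff ℝ 1 φ := hφ.of_le (by exact_mod_cast le_top)
  have hint : Integrable (vdiv φ) :=
    (continuous_vdiv hφ').integrable_of_hasCompactSupport (hasCompactSupport_vdiv hc)
  have hT : Tendsto (fun n => ∫ x, w n x * vdiv φ x) atTop (nhds (∫ x, u x * vdiv φ x)) := by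
    refine tendsto_integral_of_dominated_convergence (fun x => ‖vdiv φ x‖)
      (fun n => ((hw n).continuous.mul (continuous_vdiv hφ')).aestronglyMeasurable) hint.norm
      (fun n => Eventually.of_forall fun x => ?_) ?_
    · rw [norm_mul]
      exact mul_le_of_le_one_left (norm_nonneg _) (hw1 n x)
    · filter_upwards [hlim] with x hx using hx.mul_const _
  have hT' := (ENNReal.continuous_ofReal.tendsto _).comp hT
  simp only [Measure.restrict_univ]
  rw [← hT'.liminf_eq]
  refine liminf_le_liminf (Eventually.of_forall fun n => ?_)
  simp only [Function.comp_apply]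
  rw [integral_mul_vdiv (hw n) hφ' hc]
  calc ENNReal.ofReal (-∫ x, fderiv ℝ (w n) x (φ x))
      ≤ ‖∫ x, fderiv ℝ (w n) x (φ x)‖ₑ := by
        rw [← ofReal_norm]
        exact ENNReal.ofReal_le_ofReal (neg_le_abs _)
    _ ≤ ∫⁻ x, ‖fderiv ℝ (w n) x (φ x)‖ₑ := enorm_integral_le_lintegral_enorm _
    _ ≤ _ := lintegral_mono fun x => by
        rw [← ofReal_norm, ← ofReal_norm]
        refine ENNReal.ofReal_le_ofReal (((fderiv ℝ (w n) x).le_opNorm _).trans ?_)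
        exact mul_le_of_le_one_right (norm_nonneg _) (hφ1 x)

theorem perimeter_union_le {A B : Set (Ed d)} (hA : MeasurableSet A) (hB : MeasurableSet B)
    (hAB : Disjoint A B) : perimeter (A ∪ B) ≤ perimeter A + perimeter B := by
  refine iSup_le ?_
  rintro ⟨φ, hφ⟩
  have hφ' : ContDiff ℝ 1 φ := hφ.1.of_le (by exact_mod_cast le_top)
  have hint : Integrable (vdiv φ) :=
    (continuous_vdiv hφ').integrable_of_hasCompactSupport (hasCompactSupport_vdiv hφ.2.1)
  have hI : ∀ {S : Set (Ed d)}, MeasurableSet S →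
      Integrable fun x => S.indicator (fun _ => (1 : ℝ)) x * vdiv φ x := fun {S} hS =>
    hint.bdd_mul (c := 1) (measurable_indicator_one hS).aestronglyMeasurable
      (Eventually.of_forall fun x => norm_indicator_one_le S x)
  have hadd : ∫ x in Set.univ, (A ∪ B).indicator (fun _ => (1 : ℝ)) x * vdiv φ x =
      (∫ x in Set.univ, A.indicator (fun _ => (1 : ℝ)) x * vdiv φ x) +
        ∫ x in Set.univ, B.indicator (fun _ => (1 : ℝ)) x * vdiv φ x := by
    rw [← integral_add (by simpa using hI hA) (by simpa using hI hB)]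
    congr 1; ext x
    rw [Set.indicator_union_of_disjoint hAB, add_mul]
  simp only [hadd]
  refine ENNReal.ofReal_add_le.trans (add_le_add ?_ ?_)
  · exact le_iSup_of_le ⟨φ, hφ⟩ le_rfl
  · exact le_iSup_of_le ⟨φ, hφ⟩ le_rfl

end Divergence

section Mollify

variable {d : ℕ} (φ : ContDiffBump (0 : Ed d)) {u : Ed d → ℝ}

theorem continuous_fderiv_normed : Continuous (fderiv ℝ (φ.normed volume)) :=
  (φ.contDiff_normed (n := 1)).continuous_fderiv one_ne_zero

theorem integrable_fderiv_normed : Integrable (fderiv ℝ (φ.normed volume)) :=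
  (continuous_fderiv_normed φ).integrable_of_hasCompactSupport
    (φ.hasCompactSupport_normed.fderiv (𝕜 := ℝ))

theorem integrable_fderiv_normed_smul {V : Type*} [NormedAddCommGroup V] [NormedSpace ℝ V]
    {g : Ed d → V} (hg : StronglyMeasurable g) (hg1 : ∀ x, ‖g x‖ ≤ 1) (x a : Ed d) :
    Integrable fun t => fderiv ℝ (φ.normed volume) t a • g (x - t) :=
  ((integrable_fderiv_normed φ).apply_continuousLinearMap a).smul_bdd 1
    (hg.comp_measurable (measurable_const_sub x)).aestronglyMeasurable
    (Eventually.of_forall fun _ => hg1 _)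

theorem fderiv_convolution_normed_apply {V : Type*} [NormedAddCommGroup V] [NormedSpace ℝ V]
    [CompleteSpace V] {g : Ed d → V} (hg : StronglyMeasurable g) (hg1 : ∀ x, ‖g x‖ ≤ 1)
    (x a : Ed d) :
    fderiv ℝ (convolution (φ.normed volume) g (ContinuousLinearMap.lsmul ℝ ℝ) volume) x a =
      ∫ t, fderiv ℝ (φ.normed volume) t a • g (x - t) := by
  have hloc := locallyIntegrable_of_norm_le_one (μ := (volume : Measure (Ed d)))
    hg.aestronglyMeasurable hg1
  rw [(φ.hasCompactSupport_normed.hasFDerivAt_convolution_left (ContinuousLinearMap.lsmul ℝ ℝ)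
    (φ.contDiff_normed (n := 1)) hloc x).fderiv]
  have hex : ConvolutionExistsAt (fderiv ℝ (φ.normed volume)) g x
      (ContinuousLinearMap.precompL (Ed d) (ContinuousLinearMap.lsmul ℝ ℝ : ℝ →L[ℝ] V →L[ℝ] V))
      volume :=
    (φ.hasCompactSupport_normed.fderiv (𝕜 := ℝ)).convolutionExists_left _
      (continuous_fderiv_normed φ) hloc x
  rw [convolution, ContinuousLinearMap.integral_apply hex]
  rfl

theorem vdiv_convolution_normed {ξ : Ed d → Ed d} (hξ : Measurable ξ) (hξ1 : ∀ x, ‖ξ x‖ ≤ 1)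
    (y : Ed d) :
    vdiv (convolution (φ.normed volume) ξ (ContinuousLinearMap.lsmul ℝ ℝ) volume) y =
      ∫ x, fderiv ℝ (φ.normed volume) (y - x) (ξ x) := by
  have hI := fun a => integrable_fderiv_normed_smul φ hξ.stronglyMeasurable hξ1 y a
  calc _ = ∑ i, ∫ t, fderiv ℝ (φ.normed volume) t (EuclideanSpace.single i 1) * ξ (y - t) i := by
        refine Finset.sum_congr rfl fun i _ => ?_
        rw [fderiv_convolution_normed_apply φ hξ.stronglyMeasurable hξ1]
        exact ((EuclideanSpace.proj i : Ed d →L[ℝ] ℝ).integral_comp_comm (hI _)).symm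
    _ = ∫ t, fderiv ℝ (φ.normed volume) t (ξ (y - t)) := by
        have hI' : ∀ i, Integrable fun t =>
            fderiv ℝ (φ.normed volume) t (EuclideanSpace.single i 1) * ξ (y - t) i := fun i =>
          (EuclideanSpace.proj i : Ed d →L[ℝ] ℝ).integrable_comp (hI _)
        rw [← integral_finsetSum _ fun i _ => hI' i]
        congr 1; ext t
        exact (clm_apply_eq_sum _ _).symm
    _ = _ := by
        rw [← integral_sub_left_eq_self _ volume y]
        simp

theorem fderiv_normed_neg (x : Ed d) :
    fderiv ℝ (φ.normed volume) (-x) = - fderiv ℝ (φ.normed volume) x := by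
  have hd : HasFDerivAt (φ.normed volume) (fderiv ℝ (φ.normed volume) (-x)) (-x) :=
    ((φ.contDiff_normed (n := 1)).differentiable one_ne_zero (-x)).hasFDerivAt
  have h := (hd.comp x (hasFDerivAt_id x).neg).fderiv
  have he : φ.normed volume ∘ Neg.neg = φ.normed (volume : Measure (Ed d)) :=
    funext fun y => φ.normed_neg y
  have h' : fderiv ℝ (φ.normed volume) x = -fderiv ℝ (φ.normed volume) (-x) := by
    rw [he] at h
    rw [h]; ext; simp
  rw [h', neg_neg]

theorem integral_mul_vdiv_convolution (hu : Measurable u) (hu1 : ∀ x, ‖u x‖ ≤ 1)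
    {ξ : Ed d → Ed d} (hξ : Measurable ξ) (hξ1 : ∀ x, ‖ξ x‖ ≤ 1) (hξi : Integrable ξ) :
    ∫ y, u y * vdiv (convolution (φ.normed volume) ξ (ContinuousLinearMap.lsmul ℝ ℝ) volume) y =
      - ∫ x, fderiv ℝ (mollify φ u) x (ξ x) := by
  have hprod : Integrable (Function.uncurry fun y x =>
      u y * fderiv ℝ (φ.normed volume) (y - x) (ξ x)) (volume.prod volume) := by
    have h1 : Integrable (fun p : Ed d × Ed d =>
        fderiv ℝ (φ.normed volume) (p.1 - p.2) (ξ p.2)) (volume.prod volume) :=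
      Integrable.convolution_integrand (ContinuousLinearMap.apply ℝ ℝ) hξi
        (integrable_fderiv_normed φ)
    exact h1.bdd_mul (c := 1) (hu.comp measurable_fst).aestronglyMeasurable
      (Eventually.of_forall fun p => hu1 p.1)
  simp_rw [vdiv_convolution_normed φ hξ hξ1, ← integral_const_mul]
  rw [integral_integral_swap hprod, ← integral_neg]
  congr 1; ext x
  have h2 := fderiv_convolution_normed_apply φ hu.stronglyMeasurable hu1 x (ξ x)
  rw [mollify, h2, ← integral_sub_left_eq_self _ volume x, ← integral_neg]
  congr 1; ext y
  rw [sub_sub_cancel_left, fderiv_normed_neg]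
  simp [mul_comm]

/-- Mollification does not increase the variation. -/
theorem lintegral_fderiv_mollify_le_variation (hu : Measurable u) (hu1 : ∀ x, ‖u x‖ ≤ 1) :
    ∫⁻ x, ‖fderiv ℝ (mollify φ u) x‖ₑ ≤ variation u := by
  set w := mollify φ u with hw
  have hsm : ContDiff ℝ 1 w := contDiff_mollify φ hu hu1 (n := 1)
  have hcont : Continuous (fderiv ℝ w) := hsm.continuous_fderiv one_ne_zero
  have hball : ∀ n : ℕ, ∫⁻ x in Metric.ball (0 : Ed d) n, ‖fderiv ℝ w x‖ₑ ≤ variation u := by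
    intro n
    set g : Ed d → Ed d := fun x => (InnerProductSpace.toDual ℝ (Ed d)).symm (fderiv ℝ w x) with hg
    have hgc : Continuous g := (LinearIsometryEquiv.continuous _).comp hcont
    have hgn : ∀ x, ‖g x‖ = ‖fderiv ℝ w x‖ := fun x => LinearIsometryEquiv.norm_map _ _
    have hgi : ∀ x a, fderiv ℝ w x a = inner ℝ (g x) a := fun x a => by
      rw [hg, InnerProductSpace.toDual_symm_apply]
    set ξ : Ed d → Ed d := (Metric.ball 0 n).indicator fun x => -(‖g x‖⁻¹ • g x) with hξdef
    have hξ : Measurable ξ := by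
      refine Measurable.indicator ?_ measurableSet_ball
      have := hgc.measurable
      fun_prop
    have hξ1 : ∀ x, ‖ξ x‖ ≤ 1 := by
      intro x
      rw [hξdef, Set.indicator]
      split_ifs
      · rw [norm_neg, norm_smul, norm_inv, norm_norm]
        exact inv_mul_le_one
      · simp
    have hξc : HasCompactSupport ξ := by
      refine HasCompactSupport.intro (isCompact_closedBall (0 : Ed d) n) fun x hx => ?_
      exact Set.indicator_of_notMem (fun h => hx (Metric.ball_subset_closedBall h)) _
    have hξi : Integrable ξ := by
      refine (integrable_indicator_iff measurableSet_ball).2 ?_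
      refine Measure.integrableOn_of_bounded (M := 1) measure_ball_lt_top.ne ?_
        (Eventually.of_forall fun x => ?_)
      · have := hgc.measurable
        exact Measurable.aestronglyMeasurable (by fun_prop)
      · rw [norm_neg, norm_smul, norm_inv, norm_norm]
        exact inv_mul_le_one
    set Ψ := convolution (φ.normed volume) ξ (ContinuousLinearMap.lsmul ℝ ℝ) volume with hΨ
    have hval : ∀ x, -(fderiv ℝ w x (ξ x)) =
        (Metric.ball (0 : Ed d) n).indicator (fun x => ‖fderiv ℝ w x‖) x := by
      intro x
      by_cases hx : x ∈ Metric.ball (0 : Ed d) n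
      · rw [hξdef, Set.indicator_of_mem hx, Set.indicator_of_mem hx, map_neg, neg_neg, hgi,
          inner_smul_right, real_inner_self_eq_norm_sq, ← hgn]
        rcases eq_or_ne ‖g x‖ 0 with h | h
        · simp [h]
        · field_simp
      · rw [hξdef, Set.indicator_of_notMem hx, Set.indicator_of_notMem hx]; simp
    have hint : IntegrableOn (fun x => ‖fderiv ℝ w x‖) (Metric.ball (0 : Ed d) n) :=
      (hcont.norm.continuousOn.integrableOn_compact (isCompact_closedBall 0 (n : ℝ))).mono_set
        Metric.ball_subset_closedBall
    calc ∫⁻ x in Metric.ball (0 : Ed d) n, ‖fderiv ℝ w x‖ₑ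
        = ENNReal.ofReal (∫ x in Metric.ball (0 : Ed d) n, ‖fderiv ℝ w x‖) := by
          rw [ofReal_integral_norm_eq_lintegral_enorm]
          exact (integrable_norm_iff (hcont.aestronglyMeasurable)).1 hint
      _ = ENNReal.ofReal (∫ x in Set.univ, u x * vdiv Ψ x) := by
          rw [Measure.restrict_univ, hΨ, integral_mul_vdiv_convolution φ hu hu1 hξ hξ1 hξi,
            ← integral_neg]
          simp_rw [← hw, hval]
          rw [integral_indicator measurableSet_ball]
      _ ≤ variation u := le_iSup_of_le ⟨Ψ, φ.hasCompactSupport_normed.contDiff_convolution_left _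
          φ.contDiff_normed hξi.locallyIntegrable,
          HasCompactSupport.convolution _ φ.hasCompactSupport_normed hξc, Set.subset_univ _,
          norm_convolution_normed_le_one φ hξ1⟩ le_rfl
  have hU : (⋃ n : ℕ, Metric.ball (0 : Ed d) n) = Set.univ := Metric.iUnion_ball_nat 0
  rw [← setLIntegral_univ, ← hU, setLIntegral_iUnion_of_directed]
  · exact iSup_le hball
  · exact Monotone.directed_le fun m n h => Metric.ball_subset_ball (by exact_mod_cast h)

end Mollify

theorem liminf_add_liminf_le (f g : ℕ → ℝ≥0∞) :
    liminf f atTop + liminf g atTop ≤ liminf (fun n => f n + g n) atTop := by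
  simp only [liminf_eq_iSup_iInf_of_nat]
  rw [ENNReal.iSup_add_iSup_of_monotone]
  · exact iSup_mono fun n => le_iInf₂ fun i hi => add_le_add (iInf₂_le i hi) (iInf₂_le i hi)
  all_goals exact fun m n h => le_iInf₂ fun i hi => iInf₂_le i (h.trans hi)

theorem exists_bump_seq (d : ℕ) : ∃ φ : ℕ → ContDiffBump (0 : Ed d),
    ∀ u : Ed d → ℝ, Measurable u → (∀ x, ‖u x‖ ≤ 1) →
      ∀ᵐ x, Tendsto (fun n => mollify (φ n) u x) atTop (nhds (u x)) := by
  let φ : ℕ → ContDiffBump (0 : Ed d) := fun n =>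
    { rIn := dyadic n, rOut := 2 * dyadic n, rIn_pos := dyadic_pos n,
      rIn_lt_rOut := by linarith [dyadic_pos n] }
  refine ⟨φ, fun u hu hu1 => ?_⟩
  exact ContDiffBump.ae_convolution_tendsto_right_of_locallyIntegrable (φ := φ) (l := atTop)
    (K := 2) (by simpa using tendsto_dyadic.const_mul 2) (Eventually.of_forall fun n => le_rfl)
    (locallyIntegrable_of_norm_le_one hu.aestronglyMeasurable hu1)

section Jump

variable {d : ℕ}

theorem lintegral_fderiv_apply_le (w : Ed d → ℝ) (v : Ed d) :
    ∫⁻ x, ‖fderiv ℝ w x v‖ₑ ≤ (∫⁻ x, ‖fderiv ℝ w x‖ₑ) * ‖v‖ₑ := by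
  refine (lintegral_mono fun x => ContinuousLinearMap.le_opENorm _ _).trans ?_
  rw [lintegral_mul_const' _ _ enorm_ne_top]

theorem volume_jumpSet_le_liminf {A : Set (Ed d)} (hA : MeasurableSet A)
    {φ : ℕ → ContDiffBump (0 : Ed d)}
    (hφ : ∀ᵐ x, Tendsto (fun n => mollify (φ n) (A.indicator fun _ => (1 : ℝ)) x) atTop
      (nhds (A.indicator (fun _ => (1 : ℝ)) x))) (v : Ed d) (k : ℕ) :
    volume (jumpSet A (dyadic k • v)) ≤ ENNReal.ofReal (dyadic k) * liminf (fun n =>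
      ∫⁻ x, ‖fderiv ℝ (mollify (φ n) (A.indicator fun _ => (1 : ℝ))) x v‖ₑ) atTop := by
  rw [← lintegral_enorm_indicator_sub hA]
  exact lintegral_enorm_sub_le_liminf v (dyadic_pos k).le
    (fun n => contDiff_mollify (φ n) (measurable_indicator_one hA) (norm_indicator_one_le A)
      (n := 1)) hφ

theorem volume_jumpSet_le_perimeter {A : Set (Ed d)} (hA : MeasurableSet A) (v : Ed d) (k : ℕ) :
    volume (jumpSet A (dyadic k • v)) ≤ perimeter A * ‖v‖ₑ * ENNReal.ofReal (dyadic k) := by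
  obtain ⟨φ, hφ⟩ := exists_bump_seq d
  refine (volume_jumpSet_le_liminf hA
    (hφ _ (measurable_indicator_one hA) (norm_indicator_one_le A)) v k).trans ?_
  rw [mul_comm]
  refine mul_le_mul_left ?_ _
  refine liminf_le_of_le (by isBoundedDefault) fun b hb => ?_
  obtain ⟨n, hn⟩ := hb.exists
  refine hn.trans ((lintegral_fderiv_apply_le _ _).trans (mul_le_mul_left ?_ _))
  exact lintegral_fderiv_mollify_le_variation (φ n) (measurable_indicator_one hA)
    (norm_indicator_one_le A)

theorem jumpSet_sdiff_subset (E F : Set (Ed d)) (h : Ed d) :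
    jumpSet (E \ F) h ⊆ jumpSet E h ∪ jumpSet F h := by
  intro x hx
  simp only [jumpSet, Set.mem_ofPred_eq, Set.mem_sdiff, Set.mem_union] at hx ⊢
  tauto

/-- The points of `E` which a translation moves across the interface between `F` and `E \ F`. -/
def crossSet (E F : Set (Ed d)) (h : Ed d) : Set (Ed d) := {x | x ∈ E \ F ∧ x + h ∈ F}

theorem volume_jumpSet_add_jumpSet_sdiff_le {E F : Set (Ed d)} (hFE : F ⊆ E) (hE : MeasurableSet E)
    (hF : MeasurableSet F) (h : Ed d) :
    volume (jumpSet F h) + volume (jumpSet (E \ F) h) ≤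
      volume (jumpSet E h) + 2 * (volume (crossSet E F h) + volume (crossSet E F (-h))) := by
  set K := crossSet E F h ∪ (fun x => x + h) ⁻¹' crossSet E F (-h) with hK
  have hKv : volume K ≤ volume (crossSet E F h) + volume (crossSet E F (-h)) := by
    refine (measure_union_le _ _).trans ?_
    rw [measure_preimage_add_right]
  have h1 : jumpSet F h ∩ jumpSet (E \ F) h ⊆ K := by
    intro x ⟨hx, hx'⟩
    have := @hFE x
    have := @hFE (x + h)
    simp only [jumpSet, crossSet, hK, Set.mem_ofPred_eq, Set.mem_sdiff, Set.mem_union,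
      Set.mem_preimage, add_neg_cancel_right] at hx hx' ⊢
    tauto
  have h2 : jumpSet F h ∪ jumpSet (E \ F) h ⊆ jumpSet E h ∪ K := by
    intro x hx
    have := @hFE x
    have := @hFE (x + h)
    simp only [jumpSet, crossSet, hK, Set.mem_ofPred_eq, Set.mem_sdiff, Set.mem_union,
      Set.mem_preimage, add_neg_cancel_right] at hx ⊢
    tauto
  rw [← measure_union_add_inter _ (measurableSet_jumpSet (hE.diff hF) h)]
  calc _ ≤ (volume (jumpSet E h) + volume K) + volume K :=
        add_le_add ((measure_mono h2).trans (measure_union_le _ _)) (measure_mono h1)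
    _ ≤ _ := by
        rw [add_assoc, ← two_mul]
        gcongr

end Jump

section Assembly

variable {d : ℕ} {E F : Set (Ed d)}

theorem tendsto_volume_crossSet_div (hFE : F ⊆ E) (hE : MeasurableSet E) (hF : MeasurableSet F)
    (hEp : perimeter E < ⊤) (hFp : perimeter F < ⊤)
    (h0 : Measure.hausdorffMeasure ((d : ℝ) - 1) (essBoundary F ∩ densitySet E 1) = 0)
    (v : Ed d) :
    Tendsto (fun n => volume (crossSet E F (dyadic n • v)) / ENNReal.ofReal (dyadic n)) atTop
      (nhds 0) := by
  refine tendsto_cross_div hFE hE hF v (C := (perimeter E + perimeter F) * ‖v‖ₑ)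
    (ENNReal.mul_ne_top (ENNReal.add_lt_top.2 ⟨hEp, hFp⟩).ne enorm_ne_top) (fun n => ?_)
    (fun n => ?_) h0
  · refine (volume_jumpSet_le_perimeter hF v n).trans ?_
    gcongr
    exact le_add_self
  · refine (measure_mono (jumpSet_sdiff_subset E F _)).trans ((measure_union_le _ _).trans ?_)
    rw [add_mul, add_mul]
    exact add_le_add (volume_jumpSet_le_perimeter hE v n) (volume_jumpSet_le_perimeter hF v n)

theorem lintegral_fderiv_apply_add_le (hFE : F ⊆ E) (hE : MeasurableSet E)
    (hF : MeasurableSet F) (hEp : perimeter E < ⊤) (hFp : perimeter F < ⊤)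
    (h0 : Measure.hausdorffMeasure ((d : ℝ) - 1) (essBoundary F ∩ densitySet E 1) = 0)
    {φ : ℕ → ContDiffBump (0 : Ed d)}
    (hφ : ∀ᵐ x, Tendsto (fun n => mollify (φ n) (E.indicator fun _ => (1 : ℝ)) x) atTop
      (nhds (E.indicator (fun _ => (1 : ℝ)) x))) (ψ : ContDiffBump (0 : Ed d)) (v : Ed d) :
    (∫⁻ x, ‖fderiv ℝ (mollify ψ (F.indicator fun _ => (1 : ℝ))) x v‖ₑ) +
        ∫⁻ x, ‖fderiv ℝ (mollify ψ ((E \ F).indicator fun _ => (1 : ℝ))) x v‖ₑ ≤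
      liminf (fun n =>
        ∫⁻ x, ‖fderiv ℝ (mollify (φ n) (E.indicator fun _ => (1 : ℝ))) x v‖ₑ) atTop := by
  set J := liminf (fun n =>
    ∫⁻ x, ‖fderiv ℝ (mollify (φ n) (E.indicator fun _ => (1 : ℝ))) x v‖ₑ) atTop with hJ
  have hG := hE.diff hF
  have hle : ∀ {A : Set (Ed d)}, MeasurableSet A →
      ∫⁻ x, ‖fderiv ℝ (mollify ψ (A.indicator fun _ => (1 : ℝ))) x v‖ₑ ≤ liminf (fun k =>
        volume (jumpSet A (dyadic k • v)) / ENNReal.ofReal (dyadic k)) atTop := by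
    intro A hA
    simpa only [lintegral_enorm_indicator_sub hA] using lintegral_fderiv_mollify_le_liminf ψ
      (measurable_indicator_one hA) (norm_indicator_one_le A) v
  have hcross : Tendsto (fun k => 2 *
      (volume (crossSet E F (dyadic k • v)) / ENNReal.ofReal (dyadic k) +
        volume (crossSet E F (dyadic k • -v)) / ENNReal.ofReal (dyadic k))) atTop (nhds 0) := by
    have := ENNReal.Tendsto.const_mul (a := 2)
      ((tendsto_volume_crossSet_div hFE hE hF hEp hFp h0 v).add
        (tendsto_volume_crossSet_div hFE hE hF hEp hFp h0 (-v))) (Or.inr ENNReal.ofNat_ne_top)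
    simpa using this
  refine (add_le_add (hle hF) (hle hG)).trans ((liminf_add_liminf_le _ _).trans ?_)
  calc _ ≤ liminf (fun k => J + 2 *
      (volume (crossSet E F (dyadic k • v)) / ENNReal.ofReal (dyadic k) +
        volume (crossSet E F (dyadic k • -v)) / ENNReal.ofReal (dyadic k))) atTop := by
        refine liminf_le_liminf (Eventually.of_forall fun k => ?_)
        rw [← ENNReal.add_div, ← ENNReal.add_div, smul_neg]
        refine (ENNReal.div_le_div_right
          (volume_jumpSet_add_jumpSet_sdiff_le hFE hE hF _) _).trans ?_
        rw [ENNReal.add_div, mul_div_assoc]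
        gcongr
        refine ENNReal.div_le_of_le_mul ?_
        rw [mul_comm]
        exact volume_jumpSet_le_liminf hE hφ v k
    _ = J := by
        exact (ENNReal.liminf_add_of_right_tendsto_zero hcross fun _ => J).trans (liminf_const J)

theorem lintegral_ball_fderiv_apply {w : Ed d → ℝ} (hw : ContDiff ℝ 1 w) {κ : ℝ≥0∞}
    (hκ : κ ≠ ⊤) (hκL : ∀ L : Ed d →L[ℝ] ℝ, ∫⁻ v in Metric.ball 0 1, ‖L v‖ₑ = κ * ‖L‖ₑ) :
    ∫⁻ v in Metric.ball 0 1, ∫⁻ x, ‖fderiv ℝ w x v‖ₑ = κ * ∫⁻ x, ‖fderiv ℝ w x‖ₑ := by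
  have hc : Continuous (fderiv ℝ w) := hw.continuous_fderiv one_ne_zero
  rw [lintegral_lintegral_swap]
  · simp_rw [hκL]
    exact lintegral_const_mul' _ _ hκ
  · exact (((hc.comp continuous_snd).clm_apply continuous_fst).enorm.measurable).aemeasurable

theorem measurable_lintegral_fderiv_apply {w : Ed d → ℝ} (hw : ContDiff ℝ 1 w) :
    Measurable fun v : Ed d => ∫⁻ x, ‖fderiv ℝ w x v‖ₑ := by
  have hc : Continuous (fderiv ℝ w) := hw.continuous_fderiv one_ne_zero
  exact (((hc.comp continuous_snd).clm_apply continuous_fst).enorm.measurable).lintegral_prod_right'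

/-- If the essential boundary of `F` does not meet the measure theoretic interior of `E` in a
set of positive `(d - 1)`-dimensional measure, the perimeters of `F` and `E \ F` add up. -/
theorem perimeter_add_perimeter_sdiff_le (hFE : F ⊆ E) (hE : MeasurableSet E)
    (hF : MeasurableSet F) (hEp : perimeter E < ⊤) (hFp : perimeter F < ⊤)
    (h0 : Measure.hausdorffMeasure ((d : ℝ) - 1) (essBoundary F ∩ densitySet E 1) = 0) :
    perimeter F + perimeter (E \ F) ≤ perimeter E := by
  obtain ⟨φ, hφ⟩ := exists_bump_seq d
  obtain ⟨κ, hκ0, hκ, hκL⟩ := exists_lintegral_ball_enorm_apply d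
  have hlim : ∀ {A : Set (Ed d)}, MeasurableSet A → ∀ᵐ x,
      Tendsto (fun n => mollify (φ n) (A.indicator fun _ => (1 : ℝ)) x) atTop
        (nhds (A.indicator (fun _ => (1 : ℝ)) x)) := fun {A} hA =>
    hφ _ (measurable_indicator_one hA) (norm_indicator_one_le A)
  have hsm : ∀ {A : Set (Ed d)}, MeasurableSet A → ∀ n,
      ContDiff ℝ 1 (mollify (φ n) (A.indicator fun _ => (1 : ℝ))) := fun {A} hA n =>
    contDiff_mollify (φ n) (measurable_indicator_one hA) (norm_indicator_one_le A) (n := 1)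
  have hper : ∀ {A : Set (Ed d)}, MeasurableSet A → perimeter A ≤ liminf (fun n =>
      ∫⁻ x, ‖fderiv ℝ (mollify (φ n) (A.indicator fun _ => (1 : ℝ))) x‖ₑ) atTop := fun {A} hA =>
    variation_le_liminf (hsm hA)
      (fun n => norm_convolution_normed_le_one (φ n) (norm_indicator_one_le A)) (hlim hA)
  have hG := hE.diff hF
  have hmain : ∀ n,
      (∫⁻ x, ‖fderiv ℝ (mollify (φ n) (F.indicator fun _ => (1 : ℝ))) x‖ₑ) +
        ∫⁻ x, ‖fderiv ℝ (mollify (φ n) ((E \ F).indicator fun _ => (1 : ℝ))) x‖ₑ ≤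
      perimeter E := by
    intro n
    refine (ENNReal.mul_le_mul_iff_right hκ0 hκ).1 ?_
    rw [mul_add, ← lintegral_ball_fderiv_apply (hsm hF n) hκ hκL,
      ← lintegral_ball_fderiv_apply (hsm hG n) hκ hκL,
      ← lintegral_add_left (measurable_lintegral_fderiv_apply (hsm hF n))]
    refine (lintegral_mono fun v => lintegral_fderiv_apply_add_le hFE hE hF hEp hFp h0 (hlim hE)
      (φ n) v).trans ((lintegral_liminf_le fun m =>
        measurable_lintegral_fderiv_apply (hsm hE m)).trans ?_)
    refine liminf_le_of_le (by isBoundedDefault) fun b hb => ?_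
    obtain ⟨m, hm⟩ := hb.exists
    rw [lintegral_ball_fderiv_apply (hsm hE m) hκ hκL] at hm
    refine hm.trans ?_
    gcongr
    exact lintegral_fderiv_mollify_le_variation (φ m) (measurable_indicator_one hE)
      (norm_indicator_one_le E)
  refine (add_le_add (hper hF) (hper hG)).trans ((liminf_add_liminf_le _ _).trans ?_)
  refine liminf_le_of_le (by isBoundedDefault) fun b hb => ?_
  obtain ⟨n, hn⟩ := hb.exists
  exact hn.trans (hmain n)

theorem densitySet_zero_anti (hFE : F ⊆ E) : densitySet E 0 ⊆ densitySet F 0 := fun x hx =>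
  tendsto_of_tendsto_of_tendsto_of_le_of_le tendsto_const_nhds hx (fun _ => zero_le)
    fun r => by dsimp only; gcongr

theorem essBoundary_sdiff_essBoundary (hFE : F ⊆ E) :
    essBoundary F \ essBoundary E = essBoundary F ∩ densitySet E 1 := by
  ext x
  have := @densitySet_zero_anti d E F hFE x
  simp only [essBoundary, Set.mem_sdiff, Set.mem_compl_iff, Set.mem_union, Set.mem_inter_iff]
  tauto

end Assembly

theorem essBoundary_subset_iff_and_indecomposable_trivial
    {d : ℕ} (E F : Set (Ed d)) (hFE : F ⊆ E)
    (hEm : MeasurableSet E) (hFm : MeasurableSet F)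
    (hEper : perimeter E < ⊤) (hFper : perimeter F < ⊤) :
    ((Measure.hausdorffMeasure ((d : ℝ) - 1) (essBoundary F \ essBoundary E) = 0) ↔
      Measure.hausdorffMeasure ((d : ℝ) - 1) (essBoundary F ∩ densitySet E 1) = 0) ∧
    (Indecomposable E →
      Measure.hausdorffMeasure ((d : ℝ) - 1) (essBoundary F ∩ densitySet E 1) = 0 →
      volume F = 0 ∨ volume (E \ F) = 0) := by
  refine ⟨by rw [essBoundary_sdiff_essBoundary hFE], fun hE h0 => ?_⟩
  by_contra! hpos
  have hEF : F ∪ E \ F = E := Set.union_sdiff_cancel hFE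
  have hle := perimeter_union_le hFm (hEm.diff hFm) Set.disjoint_sdiff_right
  rw [hEF] at hle
  exact hE ⟨F, E \ F, hFm, hEm.diff hFm, hEF.symm, Set.inter_sdiff_self _ _,
    pos_iff_ne_zero.2 hpos.1, pos_iff_ne_zero.2 hpos.2,
    hle.antisymm (perimeter_add_perimeter_sdiff_le hFE hEm hFm hEper hFper h0)⟩
end
end
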